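/- arXiv:1404.7597 — 11 statements merged into one kernel-verified Lean document; each statement's English description precedes it below -/
import Mathlib

section
/- Let A and B be complex Banach algebras and let T : A → B be a (not necessarily linear nor continuous) 2-local homomorphism. If e and f are idempotents in A with ef = fe = 0, then T(e + f) = T(e) + T(f). -/
variable {A B : Type*}
  [NonUnitalNormedRing A] [NormedSpace ℂ A] [IsScalarTower ℂ A A]
  [SMulCommClass ℂ A A] [CompleteSpace A]
  [NonUnitalNormedRing B] [NormedSpace ℂ B] [IsScalarTower ℂ B B]
  [SMulCommClass ℂ B B] [CompleteSpace B]

/-- A 2-local homomorphism between complex Banach algebras: for every pair of points there is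
a bounded linear multiplicative map agreeing with `T` at those two points. -/
def IsTwoLocalHom (T : A → B) : Prop :=
  ∀ a b : A, ∃ Φ : A →L[ℂ] B, (∀ x y : A, Φ (x * y) = Φ x * Φ y) ∧ Φ a = T a ∧ Φ b = T b

/-- A 2-local homomorphism between complex Banach algebras is additive on pairs of idempotents
with zero products. -/
theorem twoLocalHom_additive_orthogonal_idempotents (T : A → B) (hT : IsTwoLocalHom T)
    (e f : A) (he : IsIdempotentElem e) (hf : IsIdempotentElem f)
    (hef : e * f = 0) (hfe : f * e = 0) :
    T (e + f) = T e + T f := by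
  have he' : e * e = e := he
  have hf' : f * f = f := hf
  set a : A := e + (2 : ℂ) • f with ha
  have haa : a * a = e + (4 : ℂ) • f := by
    simp only [ha, mul_add, add_mul, smul_mul_assoc, mul_smul_comm, he', hf', hef, hfe, smul_zero]
    module
  have h1 : (2 : ℂ) • a - a * a = e := by rw [haa, ha]; module
  have h2 : (2 : ℂ)⁻¹ • (a * a - a) = f := by rw [haa, ha]; module
  -- the images of `e` and `f` are determined by the image of `a`
  have key : ∀ Φ : A →L[ℂ] B, (∀ x y : A, Φ (x * y) = Φ x * Φ y) → Φ a = T a →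
      Φ e = (2 : ℂ) • T a - T a * T a ∧ Φ f = (2 : ℂ)⁻¹ • (T a * T a - T a) := by
    intro Φ hm h
    constructor
    · rw [← h1, map_sub, map_smul, hm, h]
    · rw [← h2, map_smul, map_sub, hm, h]
  obtain ⟨Φ₁, m₁, a₁, b₁⟩ := hT a e
  obtain ⟨Φ₂, m₂, a₂, b₂⟩ := hT a f
  obtain ⟨Φ₃, m₃, a₃, b₃⟩ := hT a (e + f)
  rw [← b₁, ← b₂, ← b₃, map_add, (key Φ₁ m₁ a₁).1, (key Φ₂ m₂ a₂).2, (key Φ₃ m₃ a₃).1,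
    (key Φ₃ m₃ a₃).2]
end

section
/- Let A and B be complex Banach algebras and let T : A → B be a (not necessarily linear nor continuous) 2-local homomorphism. Let e₁, …, eₙ be idempotents in A satisfying eᵢeⱼ = eⱼeᵢ = 0 for all i ≠ j. Then T(∑ᵢ₌₁ⁿ λᵢ eᵢ) = ∑ᵢ₌₁ⁿ λᵢ T(eᵢ) for all complex numbers λ₁, …, λₙ; in particular T(∑ᵢ₌₁ⁿ eᵢ) = ∑ᵢ₌₁ⁿ T(eᵢ). -/
variable {A B : Type*}
  [NonUnitalNormedRing A] [NormedSpace ℂ A] [IsScalarTower ℂ A A]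
  [SMulCommClass ℂ A A] [CompleteSpace A]
  [NonUnitalNormedRing B] [NormedSpace ℂ B] [IsScalarTower ℂ B B]
  [SMulCommClass ℂ B B] [CompleteSpace B]

/-- Products of combinations of orthogonal idempotents are computed coordinatewise. -/
theorem orth_mul {n : ℕ} (e : Fin n → A) (he : ∀ i, IsIdempotentElem (e i))
    (horth : ∀ i j, i ≠ j → e i * e j = 0 ∧ e j * e i = 0) (c d : Fin n → ℂ) :
    (∑ i, c i • e i) * (∑ i, d i • e i) = ∑ i, (c i * d i) • e i := by
  rw [Finset.sum_mul_sum]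
  refine Finset.sum_congr rfl fun i _ => ?_
  rw [Finset.sum_eq_single i]
  · rw [smul_mul_smul_comm, (he i).eq]
  · intro j _ hj
    rw [smul_mul_smul_comm, (horth i j hj.symm).1, smul_zero]
  · simp

/-- Homomorphisms agreeing at a combination with distinct nonzero coefficients agree at each
idempotent. -/
theorem agree_on_idempotents (F G : A →L[ℂ] B) (hF : ∀ x y : A, F (x * y) = F x * F y)
    (hG : ∀ x y : A, G (x * y) = G x * G y)
    {n : ℕ} (e : Fin n → A) (he : ∀ i, IsIdempotentElem (e i))
    (horth : ∀ i j, i ≠ j → e i * e j = 0 ∧ e j * e i = 0)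
    (m : Fin n → ℂ) (hinj : Function.Injective m) (hne : ∀ i, m i ≠ 0)
    (h : F (∑ i, m i • e i) = G (∑ i, m i • e i)) (j : Fin n) : F (e j) = G (e j) := by
  have hp : ∀ p : Polynomial ℂ,
      F (∑ i, (p.eval (m i) * m i) • e i) = G (∑ i, (p.eval (m i) * m i) • e i) := by
    intro p
    induction p using Polynomial.induction_on with
    | C a =>
      simp only [Polynomial.eval_C, mul_smul, ← Finset.smul_sum, map_smul, h]
    | add p q hp hq =>
      simp only [Polynomial.eval_add, add_mul, add_smul, Finset.sum_add_distrib, map_add, hp, hq]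
    | monomial k a ih =>
      have hk : ∀ i, (Polynomial.C a * Polynomial.X ^ (k + 1)).eval (m i) * m i
          = ((Polynomial.C a * Polynomial.X ^ k).eval (m i) * m i) * m i := by
        intro i
        simp only [Polynomial.eval_mul, Polynomial.eval_C, Polynomial.eval_pow, Polynomial.eval_X]
        ring
      simp only [hk]
      rw [← orth_mul e he horth, hF, hG, ih, h]
  have hj := hp (Lagrange.basis Finset.univ m j)
  have hs : ∑ i, ((Lagrange.basis Finset.univ m j).eval (m i) * m i) • e i = m j • e j := by
    rw [Finset.sum_eq_single j]
    · rw [Lagrange.eval_basis_self (hinj.injOn) (Finset.mem_univ j), one_mul]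
    · intro i _ hi
      rw [Lagrange.eval_basis_of_ne hi.symm (Finset.mem_univ i), zero_mul, zero_smul]
    · simp
  rw [hs, map_smul, map_smul] at hj
  exact smul_right_injective B (hne j) hj

/-- A 2-local homomorphism between complex Banach algebras is linear on finite linear
combinations of idempotents with mutually zero products. -/
theorem twoLocalHom_linear_orthogonal_idempotents (T : A → B) (hT : IsTwoLocalHom T)
    (n : ℕ) (e : Fin n → A) (he : ∀ i, IsIdempotentElem (e i))
    (horth : ∀ i j, i ≠ j → e i * e j = 0 ∧ e j * e i = 0) :
    (∀ lam : Fin n → ℂ, T (∑ i, lam i • e i) = ∑ i, lam i • T (e i)) ∧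
      T (∑ i, e i) = ∑ i, T (e i) := by
  have hinj : Function.Injective (fun i : Fin n => ((i : ℕ) : ℂ) + 1) := by
    intro i j h
    have h2 : ((i : ℕ) : ℂ) = ((j : ℕ) : ℂ) := by simpa using h
    exact Fin.ext (by exact_mod_cast h2)
  have hne : ∀ i : Fin n, ((i : ℕ) : ℂ) + 1 ≠ 0 := fun i => Nat.cast_add_one_ne_zero _
  have key : ∀ lam : Fin n → ℂ, T (∑ i, lam i • e i) = ∑ i, lam i • T (e i) := by
    intro lam
    obtain ⟨F, hF, hFa, hFb⟩ := hT (∑ i, lam i • e i) (∑ i : Fin n, (((i : ℕ) : ℂ) + 1) • e i)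
    rw [← hFa, map_sum]
    refine Finset.sum_congr rfl fun j _ => ?_
    rw [map_smul]
    congr 1
    obtain ⟨G, hG, hGa, hGb⟩ := hT (e j) (∑ i : Fin n, (((i : ℕ) : ℂ) + 1) • e i)
    rw [← hGa]
    exact agree_on_idempotents F G hF hG e he horth _ hinj hne (hFb.trans hGb.symm) j
  refine ⟨key, ?_⟩
  simpa using key (fun _ => 1)
end

section
/- Let A and B be C*-algebras and let T : A → B be a (not necessarily linear) 2-local *-homomorphism. Then T(a + i b) = T(a) + i T(b) for every pair of self-adjoint elements a, b ∈ A. -/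
variable {A B : Type*}
  [NonUnitalNormedRing A] [StarRing A] [CStarRing A] [NormedSpace ℂ A]
  [IsScalarTower ℂ A A] [SMulCommClass ℂ A A] [StarModule ℂ A] [CompleteSpace A]
  [NonUnitalNormedRing B] [StarRing B] [CStarRing B] [NormedSpace ℂ B]
  [IsScalarTower ℂ B B] [SMulCommClass ℂ B B] [StarModule ℂ B] [CompleteSpace B]

/-- A 2-local `*`-homomorphism between C*-algebras: for every pair of points there is a
`*`-homomorphism (linear, multiplicative, star-preserving) agreeing with `T` at those points. -/
def IsTwoLocalStarHom (T : A → B) : Prop :=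
  ∀ a b : A, ∃ Φ : A →⋆ₙₐ[ℂ] B, Φ a = T a ∧ Φ b = T b

/-- For every 2-local `*`-homomorphism between C*-algebras and all self-adjoint `a, b`,
`T(a + i b) = T(a) + i T(b)`. -/
theorem twoLocalStarHom_complex_combination (T : A → B) (hT : IsTwoLocalStarHom T)
    (a b : A) (ha : IsSelfAdjoint a) (hb : IsSelfAdjoint b) :
    T (a + Complex.I • b) = T a + Complex.I • T b := by
  obtain ⟨Φ, h1, h2⟩ := hT (a + Complex.I • b) a
  obtain ⟨Ψ, h3, h4⟩ := hT (a + Complex.I • b) b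
  have e : Φ a + Complex.I • Φ b = Ψ a + Complex.I • Ψ b := by
    rw [← map_smul, ← map_smul, ← map_add, ← map_add, h1, h3]
  have sa : star (Φ a) = Φ a := by rw [← map_star, ha.star_eq]
  have sb : star (Φ b) = Φ b := by rw [← map_star, hb.star_eq]
  have ta : star (Ψ a) = Ψ a := by rw [← map_star, ha.star_eq]
  have tb : star (Ψ b) = Ψ b := by rw [← map_star, hb.star_eq]
  have e' : Φ a - Complex.I • Φ b = Ψ a - Complex.I • Ψ b := by
    have := congrArg star e
    simpa [star_add, star_smul, sa, sb, ta, tb, sub_eq_add_neg] using this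
  have h2a : (2 : ℂ) • Φ a = (2 : ℂ) • Ψ a := by
    rw [two_smul, two_smul]
    calc Φ a + Φ a = (Φ a + Complex.I • Φ b) + (Φ a - Complex.I • Φ b) := by abel
      _ = (Ψ a + Complex.I • Ψ b) + (Ψ a - Complex.I • Ψ b) := by rw [e, e']
      _ = Ψ a + Ψ a := by abel
  have haa : Φ a = Ψ a := smul_right_injective B (two_ne_zero' ℂ) h2a
  rw [← h3, ← h4, ← h2, map_add, map_smul, haa]
end

section
/- Let B be a C*-algebra and let T : M₂(ℂ) → B be a (not necessarily linear) 2-local *-homomorphism from the C*-algebra of 2×2 complex matrices into B. Then T is linear and a *-homomorphism. -/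
variable {B : Type*}
  [NonUnitalNormedRing B] [StarRing B] [CStarRing B] [NormedSpace ℂ B]
  [IsScalarTower ℂ B B] [SMulCommClass ℂ B B] [StarModule ℂ B] [CompleteSpace B]

/-- A 2-local `*`-homomorphism from `M₂(ℂ)` into a C*-algebra `B`. -/
def IsTwoLocalStarHomM2 (T : Matrix (Fin 2) (Fin 2) ℂ → B) : Prop :=
  ∀ a b : Matrix (Fin 2) (Fin 2) ℂ,
    ∃ Φ : Matrix (Fin 2) (Fin 2) ℂ →⋆ₙₐ[ℂ] B, Φ a = T a ∧ Φ b = T b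

/-- The matrix unit `e₁₂` generates `M₂(ℂ)` as a `*`-algebra. -/
theorem matrix_two_decomp (x : Matrix (Fin 2) (Fin 2) ℂ) :
    x = x 0 0 • ((!![0, 1; 0, 0] : Matrix (Fin 2) (Fin 2) ℂ) * star !![0, 1; 0, 0])
      + x 0 1 • (!![0, 1; 0, 0] : Matrix (Fin 2) (Fin 2) ℂ)
      + x 1 0 • star (!![0, 1; 0, 0] : Matrix (Fin 2) (Fin 2) ℂ)
      + x 1 1 • (star (!![0, 1; 0, 0] : Matrix (Fin 2) (Fin 2) ℂ) * !![0, 1; 0, 0]) := by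
  have hs : star (!![0, 1; 0, 0] : Matrix (Fin 2) (Fin 2) ℂ) = !![0, 0; 1, 0] := by
    ext i j
    fin_cases i <;> fin_cases j <;> simp [Matrix.star_apply]
  rw [hs]
  ext i j
  fin_cases i <;> fin_cases j <;>
    simp

/-- Every (not necessarily linear) 2-local `*`-homomorphism from the C*-algebra of `2 × 2`
complex matrices into a C*-algebra is linear and a `*`-homomorphism. -/
theorem twoLocalStarHom_M2_linear (T : Matrix (Fin 2) (Fin 2) ℂ → B)
    (hT : IsTwoLocalStarHomM2 T) :
    (∀ x y, T (x + y) = T x + T y) ∧ (∀ (c : ℂ) x, T (c • x) = c • T x) ∧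
      (∀ x y, T (x * y) = T x * T y) ∧ (∀ x, T (star x) = star (T x)) := by
  obtain ⟨Ψ, hΨ, -⟩ := hT !![0, 1; 0, 0] !![0, 1; 0, 0]
  have key : ∀ x, T x = Ψ x := by
    intro x
    obtain ⟨Φ, h1, h2⟩ := hT !![0, 1; 0, 0] x
    rw [← h2, matrix_two_decomp x]
    simp only [map_add, map_smul, map_mul, map_star, h1, hΨ]
  simp only [key]
  exact ⟨map_add Ψ, map_smul Ψ, map_mul Ψ, map_star Ψ⟩
end

section
/- Let A and B be C*-algebras and let T : A → B be a (not necessarily linear) 2-local *-homomorphism. Let e₁, …, eₙ be partial isometries in A that are mutually orthogonal, that is, eᵢeⱼ* = 0 and eⱼ*eᵢ = 0 for all i ≠ j. Then T(∑ᵢ₌₁ⁿ λᵢ eᵢ) = ∑ᵢ₌₁ⁿ λᵢ T(eᵢ) for all complex numbers λ₁, …, λₙ. -/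
variable {A B : Type*}
  [NonUnitalNormedRing A] [StarRing A] [CStarRing A] [NormedSpace ℂ A]
  [IsScalarTower ℂ A A] [SMulCommClass ℂ A A] [StarModule ℂ A] [CompleteSpace A]
  [NonUnitalNormedRing B] [StarRing B] [CStarRing B] [NormedSpace ℂ B]
  [IsScalarTower ℂ B B] [SMulCommClass ℂ B B] [StarModule ℂ B] [CompleteSpace B]

open Polynomial in
lemma starHom_agree_of_agree_weighted_sum (Φ Ψ : A →⋆ₙₐ[ℂ] B) (n : ℕ) (e : Fin n → A)
    (he : ∀ i, IsIdempotentElem (e i * star (e i)))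
    (horth : ∀ i j, i ≠ j → e i * star (e j) = 0 ∧ star (e j) * e i = 0)
    (h : Φ (∑ i : Fin n, ((i : ℕ) + 1 : ℂ) • e i) = Ψ (∑ i : Fin n, ((i : ℕ) + 1 : ℂ) • e i))
    (i : Fin n) : Φ (e i) = Ψ (e i) := by
  -- partial isometries satisfy `e e* e = e`
  have htri : ∀ i, e i * star (e i) * e i = e i := by
    intro i
    rw [← sub_eq_zero, ← CStarRing.mul_star_self_eq_zero_iff]
    have h1 : e i * star (e i) * (e i * star (e i)) = e i * star (e i) := he i
    have h2 : e i * (star (e i) * (e i * star (e i))) = e i * star (e i) := by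
      rw [← mul_assoc]; exact h1
    simp only [star_sub, star_mul, star_star, mul_sub, sub_mul, mul_assoc, h2]
    simp
  set μ : Fin n → ℂ := fun i => ((i : ℕ) + 1 : ℂ) with hμ
  have hstar : ∀ i, star (μ i) = μ i := by
    intro i; simp [hμ]
  set y : A := ∑ i, μ i • e i with hy
  have hyy : ∀ i, e i * (star y * y) = (μ i ^ 2) • e i := by
    intro i
    have h1 : e i * star y = μ i • (e i * star (e i)) := by
      rw [hy, star_sum, Finset.mul_sum, Finset.sum_eq_single i]
      · rw [star_smul, hstar, mul_smul_comm]
      · intro j _ hj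
        rw [star_smul, mul_smul_comm, (horth i j hj.symm).1, smul_zero]
      · simp
    have h2 : star (e i) * y = μ i • (star (e i) * e i) := by
      rw [hy, Finset.mul_sum, Finset.sum_eq_single i]
      · rw [mul_smul_comm]
      · intro j _ hj
        rw [mul_smul_comm, (horth j i hj).2, smul_zero]
      · simp
    rw [← mul_assoc, h1, smul_mul_assoc, mul_assoc, h2, mul_smul_comm, ← mul_assoc, htri,
      smul_smul, sq]
  have hpow : ∀ k : ℕ, Φ (∑ i, (μ i ^ 2) ^ k • μ i • e i)
      = Ψ (∑ i, (μ i ^ 2) ^ k • μ i • e i) := by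
    intro k
    induction k with
    | zero => simpa only [pow_zero, one_smul] using h
    | succ k ih =>
      have : ∑ i, (μ i ^ 2) ^ (k + 1) • μ i • e i
          = (∑ i, (μ i ^ 2) ^ k • μ i • e i) * (star y * y) := by
        rw [Finset.sum_mul]
        refine Finset.sum_congr rfl fun j _ => ?_
        rw [smul_mul_assoc, smul_mul_assoc, hyy, smul_smul, smul_smul, smul_smul]
        congr 1
        ring
      rw [this, map_mul, map_mul, ih, map_mul, map_mul, map_star, map_star, h]
  have hpoly : ∀ p : ℂ[X], Φ (∑ i, p.eval (μ i ^ 2) • μ i • e i)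
      = Ψ (∑ i, p.eval (μ i ^ 2) • μ i • e i) := by
    intro p
    induction p using Polynomial.induction_on' with
    | add p q hp hq =>
      simp only [eval_add, add_smul, Finset.sum_add_distrib, map_add] at hp hq ⊢
      rw [hp, hq]
    | monomial k a =>
      simp only [eval_monomial, mul_smul]
      rw [← Finset.smul_sum, map_smul, map_smul, hpow]
  have hinj : Set.InjOn (fun j : Fin n => μ j ^ 2) (Finset.univ : Finset (Fin n)) := by
    intro a _ b _ hab
    have h1 : (((a : ℕ) + 1) ^ 2 : ℕ) = ((b : ℕ) + 1) ^ 2 := by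
      simp only [hμ] at hab
      exact_mod_cast hab
    have h2 := Nat.pow_left_injective (n := 2) (by norm_num) h1
    ext
    simpa using h2
  have hne : μ i ≠ 0 := by
    exact Nat.cast_add_one_ne_zero (i : ℕ)
  have key := hpoly (Lagrange.basis Finset.univ (fun j : Fin n => μ j ^ 2) i)
  have hs : ∑ j, (Lagrange.basis Finset.univ (fun j : Fin n => μ j ^ 2) i).eval (μ j ^ 2) •
      μ j • e j = μ i • e i := by
    rw [Finset.sum_eq_single i]
    · have := Lagrange.eval_basis_self hinj (Finset.mem_univ i)
      rw [this, one_smul]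
    · intro j _ hj
      have := Lagrange.eval_basis_of_ne (v := fun j : Fin n => μ j ^ 2) hj.symm (Finset.mem_univ j)
      rw [this, zero_smul]
    · simp
  rw [hs, map_smul, map_smul] at key
  exact smul_right_injective _ hne key

/-- Let `T` be a 2-local `*`-homomorphism between C*-algebras and let `e₁, …, eₙ` be
mutually orthogonal partial isometries. Then `T(∑ λᵢ eᵢ) = ∑ λᵢ T(eᵢ)` for all scalars. -/
theorem twoLocalStarHom_linear_orthogonal_partialIsometries (T : A → B)
    (hT : IsTwoLocalStarHom T) (n : ℕ) (e : Fin n → A)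
    (he : ∀ i, IsIdempotentElem (e i * star (e i)))
    (horth : ∀ i j, i ≠ j → e i * star (e j) = 0 ∧ star (e j) * e i = 0)
    (lam : Fin n → ℂ) :
    T (∑ i, lam i • e i) = ∑ i, lam i • T (e i) := by
  obtain ⟨Φ, hx, hy⟩ := hT (∑ i, lam i • e i) (∑ i : Fin n, ((i : ℕ) + 1 : ℂ) • e i)
  rw [← hx, map_sum]
  refine Finset.sum_congr rfl fun i _ => ?_
  obtain ⟨Ψ, hi, hy'⟩ := hT (e i) (∑ i : Fin n, ((i : ℕ) + 1 : ℂ) • e i)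
  rw [map_smul, ← hi,
    starHom_agree_of_agree_weighted_sum Φ Ψ n e he horth (hy.trans hy'.symm) i]
end

section
/- Let M be a von Neumann algebra, let B be a C*-algebra, and let T : M → B be a (not necessarily linear) 2-local *-homomorphism. Then T is orthogonally additive: for all a, b ∈ M with ab* = 0 and b*a = 0, one has T(a + b) = T(a) + T(b). -/
variable {H : Type*} [NormedAddCommGroup H] [InnerProductSpace ℂ H] [CompleteSpace H]

variable {B : Type*}
  [NonUnitalNormedRing B] [StarRing B] [CStarRing B] [NormedSpace ℂ B]
  [IsScalarTower ℂ B B] [SMulCommClass ℂ B B] [StarModule ℂ B] [CompleteSpace B]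

/-- A 2-local `*`-homomorphism from a von Neumann algebra `M` into a C*-algebra `B`. -/
def IsTwoLocalStarHomVN (M : VonNeumannAlgebra H) (T : M.toStarSubalgebra → B) : Prop :=
  ∀ a b : M.toStarSubalgebra,
    ∃ Φ : M.toStarSubalgebra →⋆ₙₐ[ℂ] B, Φ a = T a ∧ Φ b = T b

/-- A 2-local `*`-homomorphism respects `star x * x`. -/
theorem twoLocal_star_mul_self (M : VonNeumannAlgebra H)
    (T : M.toStarSubalgebra → B) (hT : IsTwoLocalStarHomVN M T)
    (x : M.toStarSubalgebra) : T (star x * x) = star (T x) * T x := by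
  obtain ⟨Φ, h1, h2⟩ := hT x (star x * x)
  rw [← h2, ← h1, map_mul, map_star]

/-- A 2-local `*`-homomorphism is additive on self-adjoint elements: both `p` and `q`
lie in the linear span of `c = p + i q` and `star c`. -/
theorem twoLocal_add_selfAdjoint (M : VonNeumannAlgebra H)
    (T : M.toStarSubalgebra → B) (hT : IsTwoLocalStarHomVN M T)
    (p q : M.toStarSubalgebra) (hp : star p = p) (hq : star q = q) :
    T (p + q) = T p + T q := by
  have hc : star (p + Complex.I • q) = p - Complex.I • q := by
    rw [star_add, star_smul, hp, hq]
    simp [sub_eq_add_neg]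
  have key : ∀ (Φ Ψ : M.toStarSubalgebra →⋆ₙₐ[ℂ] B),
      Φ (p + Complex.I • q) = Ψ (p + Complex.I • q) → Φ p = Ψ p ∧ Φ q = Ψ q := by
    intro Φ Ψ h
    have h' : Φ (p - Complex.I • q) = Ψ (p - Complex.I • q) := by
      rw [← hc, map_star, map_star, h]
    rw [map_add, map_add, map_smul, map_smul] at h
    rw [map_sub, map_sub, map_smul, map_smul] at h'
    have e1 : (2 : ℂ) • Φ p = (2 : ℂ) • Ψ p := by
      rw [two_smul, two_smul]
      calc Φ p + Φ p = (Φ p + Complex.I • Φ q) + (Φ p - Complex.I • Φ q) := by abel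
        _ = Ψ p + Ψ p := by rw [h, h']; abel
    have hpe : Φ p = Ψ p := smul_right_injective B (two_ne_zero (α := ℂ)) e1
    refine ⟨hpe, ?_⟩
    rw [hpe] at h
    exact smul_right_injective B Complex.I_ne_zero (add_left_cancel h)
  obtain ⟨Φ, h1, h2⟩ := hT (p + Complex.I • q) (p + q)
  obtain ⟨Φ₁, h3, h4⟩ := hT (p + Complex.I • q) p
  obtain ⟨Φ₂, h5, h6⟩ := hT (p + Complex.I • q) q
  rw [← h2, ← h4, ← h6, map_add, (key Φ Φ₁ (h1.trans h3.symm)).1,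
    (key Φ Φ₂ (h1.trans h5.symm)).2]

/-- Every 2-local `*`-homomorphism from a von Neumann algebra into a C*-algebra is
orthogonally additive. -/
theorem twoLocalStarHom_orthogonally_additive (M : VonNeumannAlgebra H)
    (T : M.toStarSubalgebra → B) (hT : IsTwoLocalStarHomVN M T)
    (a b : M.toStarSubalgebra) (h1 : a * star b = 0) (h2 : star b * a = 0) :
    T (a + b) = T a + T b := by
  have h3 : star a * b = 0 := by
    have := congrArg star h2
    simpa using this
  have hadd : T (star (a + b) * (a + b)) = T (star a * a) + T (star b * b) := by
    rw [← twoLocal_add_selfAdjoint M T hT _ _ (by simp) (by simp)]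
    congr 1
    rw [star_add, add_mul, mul_add, mul_add, h2, h3, zero_add, add_zero]
  rw [twoLocal_star_mul_self M T hT, twoLocal_star_mul_self M T hT,
    twoLocal_star_mul_self M T hT] at hadd
  obtain ⟨Φ, f1, f2⟩ := hT a (a + b)
  obtain ⟨Ψ, g1, g2⟩ := hT b (a + b)
  have hx1 : T (a + b) = T a + Φ b := by rw [← f2, map_add, f1]
  have hx2 : T (a + b) = Ψ a + T b := by rw [← g2, map_add, g1]
  -- orthogonality relations
  have o1 : T a * star (Φ b) = 0 := by rw [← f1, ← map_star, ← map_mul, h1, map_zero]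
  have o2 : Ψ a * star (T b) = 0 := by rw [← g1, ← map_star, ← map_mul, h1, map_zero]
  have hzz : star (Φ b) * Φ b = star (T b) * T b := by
    have e : star (T (a + b)) * T (a + b) = star (T a) * T a + star (Φ b) * Φ b := by
      rw [← f2, ← f1]
      simp only [← map_star, ← map_mul, ← map_add]
      congr 1
      rw [star_add, add_mul, mul_add, mul_add, h2, h3, zero_add, add_zero]
    exact add_left_cancel (e.symm.trans hadd)
  have o3 : T a * star (T b) = 0 := by
    rw [← CStarRing.mul_star_self_eq_zero_iff, star_mul, star_star]
    calc T a * star (T b) * (T b * star (T a))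
        = T a * (star (T b) * T b) * star (T a) := by simp only [mul_assoc]
      _ = T a * star (Φ b) * (Φ b * star (T a)) := by rw [← hzz]; simp only [mul_assoc]
      _ = 0 := by rw [o1, zero_mul]
  have o4 : Ψ a * star (Φ b) = 0 := by
    rw [← CStarRing.mul_star_self_eq_zero_iff, star_mul, star_star]
    calc Ψ a * star (Φ b) * (Φ b * star (Ψ a))
        = Ψ a * (star (Φ b) * Φ b) * star (Ψ a) := by simp only [mul_assoc]
      _ = Ψ a * star (T b) * (T b * star (Ψ a)) := by rw [hzz]; simp only [mul_assoc]
      _ = 0 := by rw [o2, zero_mul]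
  have hw : T a - Ψ a = T b - Φ b := by
    rw [sub_eq_sub_iff_add_eq_add, ← hx1, hx2, add_comm]
  have hw0 : T b - Φ b = 0 := by
    rw [← CStarRing.mul_star_self_eq_zero_iff]
    nth_rewrite 1 [← hw]
    rw [star_sub, sub_mul, mul_sub, mul_sub, o1, o2, o3, o4]
    simp
  rw [hx1, sub_eq_zero.mp hw0]
end

section
/- Every (not necessarily linear nor continuous) 2-local *-homomorphism from a von Neumann algebra into a C*-algebra is linear and a *-homomorphism. -/
variable {H : Type*} [NormedAddCommGroup H] [InnerProductSpace ℂ H] [CompleteSpace H]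

variable {B : Type*}
  [NonUnitalNormedRing B] [StarRing B] [CStarRing B] [NormedSpace ℂ B]
  [IsScalarTower ℂ B B] [SMulCommClass ℂ B B] [StarModule ℂ B] [CompleteSpace B]

/-- Every (not necessarily linear nor continuous) 2-local `*`-homomorphism from a von Neumann
algebra into a C*-algebra is linear and a `*`-homomorphism. -/
theorem twoLocalStarHom_vonNeumann_linear (M : VonNeumannAlgebra H)
    (T : M.toStarSubalgebra → B) (hT : IsTwoLocalStarHomVN M T) :
    (∀ x y, T (x + y) = T x + T y) ∧ (∀ (c : ℂ) x, T (c • x) = c • T x) ∧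
      (∀ x y, T (x * y) = T x * T y) ∧ (∀ x, T (star x) = star (T x)) := by
  have hstar : ∀ x, T (star x) = star (T x) := by
    intro x
    obtain ⟨Φ, h1, h2⟩ := hT x (star x)
    rw [← h2, ← h1, map_star]
  have hsmul : ∀ (c : ℂ) x, T (c • x) = c • T x := by
    intro c x
    obtain ⟨Φ, h1, h2⟩ := hT x (c • x)
    rw [← h2, ← h1, map_smul]
  have hI : Complex.I * Complex.I = -1 := Complex.I_mul_I
  -- real and imaginary parts are recovered from `z = x + i y`
  have hre : ∀ x y : M.toStarSubalgebra, star x = x → star y = y →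
      T x = (1/2 : ℂ) • (T (x + Complex.I • y) + star (T (x + Complex.I • y))) := by
    intro x y hx hy
    obtain ⟨Φ, h1, h2⟩ := hT (x + Complex.I • y) x
    rw [← h1, ← h2, ← map_star, ← map_add, ← map_smul]
    congr 1
    simp only [star_add, star_smul, hx, hy, Complex.star_def, Complex.conj_I]
    module
  have him : ∀ x y : M.toStarSubalgebra, star x = x → star y = y →
      T y = (-Complex.I/2 : ℂ) • (T (x + Complex.I • y) - star (T (x + Complex.I • y))) := by
    intro x y hx hy
    obtain ⟨Φ, h1, h2⟩ := hT (x + Complex.I • y) y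
    rw [← h1, ← h2, ← map_star, ← map_sub, ← map_smul]
    congr 1
    simp only [star_add, star_smul, hx, hy, Complex.star_def, Complex.conj_I]
    match_scalars <;> first | ring1 | linear_combination hI | linear_combination (-1 : ℂ) * hI |
        linear_combination (1/2 : ℂ) * hI | linear_combination (-1/2 : ℂ) * hI
  have hz : ∀ x y : M.toStarSubalgebra, star x = x → star y = y →
      T (x + Complex.I • y) = T x + Complex.I • T y := by
    intro x y hx hy
    rw [hre x y hx hy, him x y hx hy]
    match_scalars <;> first | ring1 | linear_combination hI | linear_combination (-1 : ℂ) * hI |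
        linear_combination (1/2 : ℂ) * hI | linear_combination (-1/2 : ℂ) * hI
  -- every *-homomorphism agreeing with `T` at `z` agrees with `T` at `x` and `y`
  have hkey : ∀ x y w : M.toStarSubalgebra, star x = x → star y = y →
      ∃ Φ : M.toStarSubalgebra →⋆ₙₐ[ℂ] B, Φ x = T x ∧ Φ y = T y ∧ Φ w = T w := by
    intro x y w hx hy
    obtain ⟨Φ, h1, h2⟩ := hT (x + Complex.I • y) w
    refine ⟨Φ, ?_, ?_, h2⟩
    · rw [hre x y hx hy, ← h1, ← map_star, ← map_add, ← map_smul]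
      congr 1
      simp only [star_add, star_smul, hx, hy, Complex.star_def, Complex.conj_I]
      module
    · rw [him x y hx hy, ← h1, ← map_star, ← map_sub, ← map_smul]
      congr 1
      simp only [star_add, star_smul, hx, hy, Complex.star_def, Complex.conj_I]
      match_scalars <;> first | ring1 | linear_combination hI | linear_combination (-1 : ℂ) * hI |
        linear_combination (1/2 : ℂ) * hI | linear_combination (-1/2 : ℂ) * hI
  have hdec : ∀ a : M.toStarSubalgebra, ∃ x y : M.toStarSubalgebra,
      star x = x ∧ star y = y ∧ a = x + Complex.I • y := by
    intro a
    refine ⟨(1/2 : ℂ) • (a + star a), (-Complex.I/2 : ℂ) • (a - star a), ?_, ?_, ?_⟩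
    · simp [star_smul, add_comm]
    · simp only [star_smul, star_sub, star_star, Complex.star_def, map_div₀, map_neg,
        Complex.conj_I, map_ofNat]
      module
    · match_scalars <;> first | ring1 | linear_combination hI | linear_combination (-1 : ℂ) * hI |
        linear_combination (1/2 : ℂ) * hI | linear_combination (-1/2 : ℂ) * hI
  have haddsa : ∀ x y : M.toStarSubalgebra, star x = x → star y = y →
      T (x + y) = T x + T y := by
    intro x y hx hy
    obtain ⟨Φ, h1, h2, h3⟩ := hkey x y (x + y) hx hy
    rw [← h1, ← h2, ← h3, map_add]
  have hmulsa : ∀ x y : M.toStarSubalgebra, star x = x → star y = y →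
      T (x * y) = T x * T y := by
    intro x y hx hy
    obtain ⟨Φ, h1, h2, h3⟩ := hkey x y (x * y) hx hy
    rw [← h1, ← h2, ← h3, map_mul]
  have hadd : ∀ a b, T (a + b) = T a + T b := by
    intro a b
    obtain ⟨x, y, hx, hy, rfl⟩ := hdec a
    obtain ⟨u, v, hu, hv, rfl⟩ := hdec b
    have e : x + Complex.I • y + (u + Complex.I • v) = (x + u) + Complex.I • (y + v) := by
      module
    rw [e, hz _ _ (by rw [star_add, hx, hu]) (by rw [star_add, hy, hv]), hz x y hx hy,
      hz u v hu hv, haddsa x u hx hu, haddsa y v hy hv]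
    module
  refine ⟨hadd, hsmul, ?_, hstar⟩
  intro a b
  obtain ⟨x, y, hx, hy, rfl⟩ := hdec a
  obtain ⟨u, v, hu, hv, rfl⟩ := hdec b
  simp only [add_mul, mul_add, smul_mul_assoc, mul_smul_comm, hadd, hsmul,
    hmulsa x u hx hu, hmulsa x v hx hv, hmulsa y u hy hu, hmulsa y v hy hv]
end

section
/- Let M be a von Neumann algebra and let T : M → M be a surjective (not necessarily linear) 2-local *-automorphism. Then T is a *-automorphism of M. -/
variable {H : Type*} [NormedAddCommGroup H] [InnerProductSpace ℂ H] [CompleteSpace H]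

/-- A 2-local `*`-automorphism of a von Neumann algebra `M`: for every pair of points there
is a `*`-automorphism (a bijective linear, multiplicative, star-preserving map) agreeing with
`T` at those two points. -/
def IsTwoLocalStarAut (M : VonNeumannAlgebra H) (T : M.toStarSubalgebra → M.toStarSubalgebra) :
    Prop :=
  ∀ a b : M.toStarSubalgebra,
    ∃ Φ : M.toStarSubalgebra ≃⋆ₐ[ℂ] M.toStarSubalgebra, Φ a = T a ∧ Φ b = T b

/-- The general C*-algebra version: a surjective 2-local `*`-automorphism is an isometry, hence
linear by Mazur--Ulam; it satisfies `T (x⋆ x) = (T x)⋆ (T x)`, and polarization concludes. -/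
theorem twoLocal_cstar_aux {A : Type*} [CStarAlgebra A] (T : A → A)
    (hsurj : Function.Surjective T)
    (hT : ∀ a b : A, ∃ Φ : A ≃⋆ₐ[ℂ] A, Φ a = T a ∧ Φ b = T b) :
    ∃ Ψ : A ≃⋆ₐ[ℂ] A, ∀ x, Ψ x = T x := by
  have hiso : Isometry T := by
    refine Isometry.of_dist_eq fun a b => ?_
    obtain ⟨Φ, ha, hb⟩ := hT a b
    rw [← ha, ← hb]
    exact (StarAlgEquiv.isometry Φ).dist_eq a b
  have h0 : T 0 = 0 := by
    obtain ⟨Φ, ha, -⟩ := hT 0 0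
    rw [← ha, map_zero]
  have hsmul : ∀ (c : ℂ) (a : A), T (c • a) = c • T a := by
    intro c a
    obtain ⟨Φ, ha, hb⟩ := hT a (c • a)
    rw [← ha, ← hb, map_smul]
  have hstar : ∀ a : A, T (star a) = star (T a) := by
    intro a
    obtain ⟨Φ, ha, hb⟩ := hT a (star a)
    rw [← ha, ← hb, map_star]
  have hss : ∀ a : A, T (star a * a) = star (T a) * T a := by
    intro a
    obtain ⟨Φ, ha, hb⟩ := hT a (star a * a)
    rw [← ha, ← hb, map_mul, map_star]
  have hadd : ∀ a b : A, T (a + b) = T a + T b := by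
    let e : A ≃ᵢ A := ⟨Equiv.ofBijective T ⟨hiso.injective, hsurj⟩, hiso⟩
    exact fun a b => map_add (e.toRealLinearIsometryEquivOfMapZero h0) a b
  have hpol : ∀ a b : A, T (star a * b) + T (star b * a)
      = star (T a) * T b + star (T b) * T a := by
    intro a b
    have h := hss (a + b)
    simp only [star_add, add_mul, mul_add, hadd, hss] at h
    have h2 : ∀ p q r s r' s' : A, p + r + (s + q) = p + r' + (s' + q) → s + r = s' + r' := by
      intro p q r s r' s' h
      have := congrArg (fun z => z - p - q) h
      calc s + r = p + r + (s + q) - p - q := by abel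
        _ = p + r' + (s' + q) - p - q := this
        _ = s' + r' := by abel
    exact h2 _ _ _ _ _ _ h
  have hpol2 : ∀ a b : A, T (star a * b) - T (star b * a)
      = star (T a) * T b - star (T b) * T a := by
    intro a b
    have h := hpol a (Complex.I • b)
    have hI : ∀ x y : A, star (Complex.I • x) * y = (-Complex.I) • (star x * y) := by
      intro x y
      have h1 : star (Complex.I • x) = (-Complex.I) • star x := by
        rw [star_smul, Complex.star_def, Complex.conj_I]
      rw [h1]
      exact smul_mul_assoc _ _ _
    rw [hsmul, hI, hI, mul_smul_comm, mul_smul_comm, hsmul, hsmul, neg_smul, neg_smul,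
      ← sub_eq_add_neg, ← sub_eq_add_neg, ← smul_sub, ← smul_sub] at h
    exact smul_right_injective A Complex.I_ne_zero h
  have hmul' : ∀ a b : A, T (star a * b) = star (T a) * T b := by
    intro a b
    have h := congrArg₂ (· + ·) (hpol a b) (hpol2 a b)
    simp only [add_add_sub_cancel, ← two_smul ℂ] at h
    exact smul_right_injective A (two_ne_zero (α := ℂ)) h
  have hmul : ∀ a b : A, T (a * b) = T a * T b := by
    intro a b
    have h := hmul' (star a) b
    rwa [hstar, star_star, star_star] at h
  exact ⟨{ Equiv.ofBijective T ⟨hiso.injective, hsurj⟩ with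
    map_mul' := hmul
    map_add' := hadd
    map_star' := hstar
    map_smul' := hsmul }, fun x => rfl⟩

/-- Every surjective (not necessarily linear) 2-local `*`-automorphism of a von Neumann
algebra is a `*`-automorphism. -/
theorem twoLocalStarAut_vonNeumann (M : VonNeumannAlgebra H)
    (T : M.toStarSubalgebra → M.toStarSubalgebra) (hsurj : Function.Surjective T)
    (hT : IsTwoLocalStarAut M T) :
    ∃ Ψ : M.toStarSubalgebra ≃⋆ₐ[ℂ] M.toStarSubalgebra, ∀ x, Ψ x = T x := by
  have hc : IsClosed (M.toStarSubalgebra : Set (H →L[ℂ] H)) := by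
    have h := Set.isClosed_centralizer (Set.centralizer (M : Set (H →L[ℂ] H)))
    rwa [M.centralizer_centralizer] at h
  exact twoLocal_cstar_aux T hsurj hT
end

section
/- Let A and B be C*-algebras and let T : A → B be a (not necessarily linear) 2-local *-homomorphism. Then for each self-adjoint element h ∈ A, the restriction of T to the C*-subalgebra of A generated by h is a linear map. -/
variable {A B : Type*}
  [NonUnitalNormedRing A] [StarRing A] [CStarRing A] [NormedSpace ℂ A]
  [IsScalarTower ℂ A A] [SMulCommClass ℂ A A] [StarModule ℂ A] [CompleteSpace A]
  [NonUnitalNormedRing B] [StarRing B] [CStarRing B] [NormedSpace ℂ B]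
  [IsScalarTower ℂ B B] [SMulCommClass ℂ B B] [StarModule ℂ B] [CompleteSpace B]

/-- Star homomorphisms between C*-algebras are continuous. -/
theorem continuous_starHom_aux {A B : Type*}
    [NonUnitalNormedRing A] [StarRing A] [CStarRing A] [NormedSpace ℂ A]
    [IsScalarTower ℂ A A] [SMulCommClass ℂ A A] [StarModule ℂ A] [CompleteSpace A]
    [NonUnitalNormedRing B] [StarRing B] [CStarRing B] [NormedSpace ℂ B]
    [IsScalarTower ℂ B B] [SMulCommClass ℂ B B] [StarModule ℂ B] [CompleteSpace B]
    (Φ : A →⋆ₙₐ[ℂ] B) : Continuous Φ := by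
  let : NonUnitalCStarAlgebra A := {}
  let : NonUnitalCStarAlgebra B := {}
  exact AddMonoidHomClass.continuous_of_bound Φ 1 (fun x => by
    simpa using NonUnitalStarAlgHom.norm_apply_le Φ x)

/-- For every 2-local `*`-homomorphism `T` between C*-algebras and every self-adjoint
`h ∈ A`, the restriction of `T` to the C*-subalgebra of `A` generated by `h` (the closure
of the non-unital star subalgebra generated by `h`) is linear. -/
theorem twoLocalStarHom_linear_on_elemental (T : A → B) (hT : IsTwoLocalStarHom T)
    (h : A) (hh : IsSelfAdjoint h) :
    ∀ x ∈ closure ((NonUnitalStarAlgebra.adjoin ℂ {h} : NonUnitalStarSubalgebra ℂ A) : Set A),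
      ∀ y ∈ closure ((NonUnitalStarAlgebra.adjoin ℂ {h} : NonUnitalStarSubalgebra ℂ A) : Set A),
        ∀ c : ℂ, T (x + y) = T x + T y ∧ T (c • x) = c • T x := by
  obtain ⟨Φ, hΦ, -⟩ := hT h h
  have key : ∀ z ∈ closure ((NonUnitalStarAlgebra.adjoin ℂ {h} :
      NonUnitalStarSubalgebra ℂ A) : Set A), T z = Φ z := by
    intro z hz
    obtain ⟨Ψ, h1, h2⟩ := hT h z
    rw [← h2]
    have hle : NonUnitalStarAlgebra.adjoin ℂ {h} ≤ NonUnitalStarAlgHom.equalizer Ψ Φ := by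
      apply NonUnitalStarAlgebra.adjoin_le
      rintro w rfl
      exact h1.trans hΦ.symm
    have heq : Set.EqOn Ψ Φ ((NonUnitalStarAlgebra.adjoin ℂ {h} :
      NonUnitalStarSubalgebra ℂ A) : Set A) := fun w hw => hle hw
    exact heq.closure (continuous_starHom_aux Ψ) (continuous_starHom_aux Φ) hz
  intro x hx y hy c
  have hxy : x + y ∈ closure ((NonUnitalStarAlgebra.adjoin ℂ {h} :
      NonUnitalStarSubalgebra ℂ A) : Set A) :=
    map_mem_closure₂ continuous_add hx hy fun a ha b hb => add_mem ha hb
  refine ⟨by rw [key _ hxy, key _ hx, key _ hy, map_add], ?_⟩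
  obtain ⟨Ψ, h1, h2⟩ := hT x (c • x)
  rw [← h1, ← h2, map_smul]
end

section
/- Let H be a complex Hilbert space, let K(H) denote the C*-algebra of all compact linear operators on H, and let B be a C*-algebra. Then every (not necessarily linear) 2-local *-homomorphism T : K(H) → B is linear and a *-homomorphism. -/
open InnerProductSpace in
theorem aux_rankOne_compact {H : Type*} [NormedAddCommGroup H] [InnerProductSpace ℂ H]
    (x y : H) : IsCompactOperator (rankOne ℂ x y : H → H) := by
  have h : IsCompactOperator (id : ℂ → ℂ) := isCompactOperator_id
  have h2 := (h.clm_comp (ContinuousLinearMap.toSpanSingleton ℂ x)).comp_clm (innerSL ℂ y)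
  exact h2

theorem aux_approx {H : Type*} [NormedAddCommGroup H] [InnerProductSpace ℂ H]
    (a : H →L[ℂ] H) (ha : IsCompactOperator (a : H → H)) {ε : ℝ} (hε : 0 < ε) :
    ∃ V : Submodule ℂ H, FiniteDimensional ℂ V ∧
      ∀ W : Submodule ℂ H, FiniteDimensional ℂ W → V ≤ W → ∀ [W.HasOrthogonalProjection],
        ‖a - W.starProjection * a‖ ≤ ε := by
  obtain ⟨C, hC, hsub⟩ := IsCompactOperator.image_closedBall_subset_compact
    (f := (a : H →ₗ[ℂ] H)) ha 1
  obtain ⟨t, htC, htf, ht⟩ := hC.finite_cover_balls hε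
  refine ⟨Submodule.span ℂ t, FiniteDimensional.span_of_finite ℂ htf, ?_⟩
  intro W _ hW _
  refine ContinuousLinearMap.opNorm_le_of_unit_norm hε.le fun x hx => ?_
  have hx' : a x ∈ C := hsub ⟨x, by simp [hx], rfl⟩
  obtain ⟨y, hy, hxy⟩ := Set.mem_iUnion₂.1 (ht hx')
  have hyW : y ∈ W := hW (Submodule.subset_span hy)
  have : ‖a x - W.starProjection (a x)‖ ≤ ‖a x - y‖ := by
    rw [Submodule.starProjection_minimal]
    exact ciInf_le ⟨0, by rintro _ ⟨z, rfl⟩; exact norm_nonneg _⟩ (⟨y, hyW⟩ : W)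
  rw [Metric.mem_ball, dist_eq_norm] at hxy
  simpa using! this.trans hxy.le

theorem aux_approx2 {H : Type*} [NormedAddCommGroup H] [InnerProductSpace ℂ H] [CompleteSpace H]
    (a : H →L[ℂ] H) (ha : IsCompactOperator (a : H → H))
    (ha' : IsCompactOperator (star a : H →L[ℂ] H)) {ε : ℝ} (hε : 0 < ε) :
    ∃ V : Submodule ℂ H, FiniteDimensional ℂ V ∧
      ∀ W : Submodule ℂ H, FiniteDimensional ℂ W → V ≤ W → ∀ [W.HasOrthogonalProjection],
        ‖W.starProjection * a * W.starProjection - a‖ ≤ ε := by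
  obtain ⟨V, hV, h⟩ := aux_approx a ha (half_pos hε)
  obtain ⟨V', hV', h'⟩ := aux_approx (star a) ha' (half_pos hε)
  refine ⟨V ⊔ V', inferInstance, ?_⟩
  intro W hW hle _
  have h1 := h W hW (le_sup_left.trans hle)
  have h2 := h' W hW (le_sup_right.trans hle)
  have hs : star (W.starProjection) = W.starProjection :=
    (isStarProjection_starProjection (U := W)).isSelfAdjoint
  have h3 : ‖a - a * W.starProjection‖ ≤ ε / 2 := by
    rw [← norm_star, star_sub, star_mul, hs]; exact h2
  have hP : ‖W.starProjection‖ ≤ 1 := W.starProjection_norm_le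
  calc ‖W.starProjection * a * W.starProjection - a‖
      = ‖(a - W.starProjection * a) + W.starProjection * (a - a * W.starProjection)‖ := by
        rw [← norm_neg]; congr 1; noncomm_ring
    _ ≤ ‖a - W.starProjection * a‖ + ‖W.starProjection‖ * ‖a - a * W.starProjection‖ :=
        (norm_add_le _ _).trans (by gcongr; exact norm_mul_le _ _)
    _ ≤ ε / 2 + 1 * (ε / 2) := by gcongr
    _ = ε := by ring

theorem aux_contractive {H : Type*} [NormedAddCommGroup H] [InnerProductSpace ℂ H]
    [CompleteSpace H] {B : Type*}
    [NonUnitalNormedRing B] [StarRing B] [CStarRing B] [NormedSpace ℂ B]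
    [IsScalarTower ℂ B B] [SMulCommClass ℂ B B] [StarModule ℂ B] [CompleteSpace B]
    (K : NonUnitalStarSubalgebra ℂ (H →L[ℂ] H))
    (hK : ∀ f : H →L[ℂ] H, f ∈ K ↔ IsCompactOperator (f : H → H))
    (Φ : K →⋆ₙₐ[ℂ] B) (a : K) : ‖Φ a‖ ≤ ‖(a : H →L[ℂ] H)‖ := by
  letI : NonUnitalCStarAlgebra B := {}
  haveI : IsClosed (K : Set (H →L[ℂ] H)) := by
    have : (K : Set (H →L[ℂ] H)) = {f : H →L[ℂ] H | IsCompactOperator (f : H → H)} := by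
      ext f; exact hK f
    rw [this]; exact isClosed_setOfPred_isCompactOperator
  exact NonUnitalStarAlgHom.norm_apply_le Φ a

section algebra

variable {A B : Type*} [NonUnitalRing A] [StarRing A] [Module ℂ A]
    [IsScalarTower ℂ A A] [SMulCommClass ℂ A A]
    [NonUnitalRing B] [StarRing B] [Module ℂ B]
    [IsScalarTower ℂ B B] [SMulCommClass ℂ B B]

theorem aux_orth (T : A → B) (hT : ∀ a b : A, ∃ Φ : A →⋆ₙₐ[ℂ] B, Φ a = T a ∧ Φ b = T b)
    (p q : A) (hp : p * p = p) (hq : q * q = q) (hpq : p * q = 0) (hqp : q * p = 0) :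
    T (p + q) = T p + T q := by
  set a := p + (2 : ℂ) • q with ha
  have haa : a * a = p + (4 : ℂ) • q := by
    simp only [ha, mul_add, add_mul, mul_smul_comm, smul_mul_assoc, hp, hq, hpq, hqp]
    module
  have e1 : T p = (2 : ℂ) • T a - T a * T a := by
    obtain ⟨Φ, h1, h2⟩ := hT a p
    rw [← h1, ← h2, ← map_mul, ← map_smul, ← map_sub, haa, ha]
    congr 1; module
  have e2 : T q = (1 / 2 : ℂ) • (T a * T a) - (1 / 2 : ℂ) • T a := by
    obtain ⟨Φ, h1, h2⟩ := hT a q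
    rw [← h1, ← h2, ← map_mul, ← map_smul, ← map_smul, ← map_sub, haa, ha]
    congr 1; module
  have e3 : T (p + q) = (3 / 2 : ℂ) • T a - (1 / 2 : ℂ) • (T a * T a) := by
    obtain ⟨Φ, h1, h2⟩ := hT a (p + q)
    rw [← h1, ← h2, ← map_mul, ← map_smul, ← map_smul, ← map_sub, haa, ha]
    congr 1; module
  rw [e1, e2, e3]; module

theorem aux_zero (T : A → B) (hT : ∀ a b : A, ∃ Φ : A →⋆ₙₐ[ℂ] B, Φ a = T a ∧ Φ b = T b) :
    T 0 = 0 := by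
  obtain ⟨Φ, h1, h2⟩ := hT 0 0
  rw [← h1, map_zero]

theorem aux_sum (T : A → B) (hT : ∀ a b : A, ∃ Φ : A →⋆ₙₐ[ℂ] B, Φ a = T a ∧ Φ b = T b)
    {ι : Type*} [DecidableEq ι] (p : ι → A)
    (hp : ∀ i j, p i * p j = if i = j then p i else 0) (s : Finset ι) :
    T (∑ i ∈ s, p i) = ∑ i ∈ s, T (p i) := by
  induction s using Finset.induction_on with
  | empty => simpa using aux_zero T hT
  | insert i s hi ih =>
    rw [Finset.sum_insert hi, Finset.sum_insert hi, ← ih]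
    apply aux_orth T hT
    · simp [hp]
    · rw [Finset.sum_mul_sum]
      apply Finset.sum_congr rfl
      intro j hj
      simp [hp, hj]
    · rw [Finset.mul_sum]
      apply Finset.sum_eq_zero
      intro j hj
      rw [hp, if_neg]; rintro rfl; exact hi hj
    · rw [Finset.sum_mul]
      apply Finset.sum_eq_zero
      intro j hj
      rw [hp, if_neg]; rintro rfl; exact hi hj

/-- If `x a x`, `x b x`, `x (a+b) x` are multiples of `x`, then the defect of additivity
is killed by the support projections of `x`. -/
theorem aux_defect (T : A → B) (hT : ∀ a b : A, ∃ Φ : A →⋆ₙₐ[ℂ] B, Φ a = T a ∧ Φ b = T b)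
    (x a b : A) (l m : ℂ) (ha : x * a * x = l • x) (hb : x * b * x = m • x) :
    T (star x * x) * (T (a + b) - T a - T b) * T (x * star x) = 0 := by
  have key : ∀ (c : A) (l : ℂ), x * c * x = l • x → T x * T c * T x = l • T x := by
    intro c l h
    obtain ⟨Φ, h1, h2⟩ := hT x c
    rw [← h1, ← h2, ← map_mul, ← map_mul, h, map_smul]
  have e1 := key a l ha
  have e2 := key b m hb
  have e3 := key (a + b) (l + m) (by rw [mul_add, add_mul, ha, hb, add_smul])
  have f1 : T (star x * x) = star (T x) * T x := by
    obtain ⟨Φ, h1, h2⟩ := hT x (star x * x)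
    rw [← h1, ← h2, map_mul, map_star]
  have f2 : T (x * star x) = T x * star (T x) := by
    obtain ⟨Φ, h1, h2⟩ := hT x (x * star x)
    rw [← h1, ← h2, map_mul, map_star]
  have : T x * (T (a + b) - T a - T b) * T x = 0 := by
    rw [mul_sub, mul_sub, sub_mul, sub_mul, e1, e2, e3]; module
  rw [f1, f2]
  calc _ = star (T x) * (T x * (T (a + b) - T a - T b) * T x) * star (T x) := by
        simp only [mul_assoc]
    _ = 0 := by rw [this]; simp

theorem aux_final [StarModule ℂ A] [StarModule ℂ B] (T : A → B)
    (hT : ∀ a b : A, ∃ Φ : A →⋆ₙₐ[ℂ] B, Φ a = T a ∧ Φ b = T b)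
    (hadd : ∀ x y, T (x + y) = T x + T y) :
    (∀ x y, T (x + y) = T x + T y) ∧ (∀ (c : ℂ) x, T (c • x) = c • T x) ∧
      (∀ x y, T (x * y) = T x * T y) ∧ (∀ x, T (star x) = star (T x)) := by
  have hsmul : ∀ (c : ℂ) x, T (c • x) = c • T x := by
    intro c x
    obtain ⟨Φ, h1, h2⟩ := hT x (c • x)
    rw [← h1, ← h2, map_smul]
  have hstar : ∀ x, T (star x) = star (T x) := by
    intro x
    obtain ⟨Φ, h1, h2⟩ := hT x (star x)
    rw [← h1, ← h2, map_star]
  have hsq : ∀ x, T (x * star x) = T x * star (T x) := by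
    intro x
    obtain ⟨Φ, h1, h2⟩ := hT x (x * star x)
    rw [← h1, ← h2, map_mul, map_star]
  have hpol : ∀ x y, T (x * star y) + T (y * star x)
      = T x * star (T y) + T y * star (T x) := by
    intro x y
    have h := hsq (x + y)
    simp only [star_add, mul_add, add_mul, hadd, hsq] at h
    rw [← sub_eq_zero] at h ⊢
    rw [← h]; abel
  refine ⟨hadd, hsmul, ?_, hstar⟩
  have hmul : ∀ x y, T (x * star y) = T x * star (T y) := by
    intro x y
    have h1 := hpol x y
    have h2 := hpol x (Complex.I • y)
    simp only [star_smul, mul_smul_comm, smul_mul_assoc, hsmul, Complex.star_def,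
      Complex.conj_I] at h2
    have h3 := congrArg (fun z => Complex.I • z) h2
    simp only [smul_add, smul_neg, smul_smul, Complex.I_mul_I, neg_neg, one_smul, neg_smul] at h3
    have h4 : (2 : ℂ) • T (x * star y) = (2 : ℂ) • (T x * star (T y)) := by
      rw [two_smul, two_smul, ← sub_eq_zero]
      rw [← sub_eq_zero] at h1 h3
      have := congrArg₂ (· + ·) h1 h3
      simp only [add_zero] at this
      rw [← this]; abel
    have h5 := congrArg (fun z => (1 / 2 : ℂ) • z) h4
    simpa [smul_smul] using h5
  intro x y
  have := hmul x (star y)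
  rwa [hstar, star_star, star_star] at this

end algebra

section main

variable {H : Type*} [NormedAddCommGroup H] [InnerProductSpace ℂ H] [CompleteSpace H]

variable {B : Type*}
  [NonUnitalNormedRing B] [StarRing B] [CStarRing B] [NormedSpace ℂ B]
  [IsScalarTower ℂ B B] [SMulCommClass ℂ B B] [StarModule ℂ B] [CompleteSpace B]

open InnerProductSpace in
theorem aux_proj
    (K : NonUnitalStarSubalgebra ℂ (H →L[ℂ] H))
    (hK : ∀ f : H →L[ℂ] H, f ∈ K ↔ IsCompactOperator (f : H → H))
    (T : K → B)
    (hT : ∀ a b : K, ∃ Φ : K →⋆ₙₐ[ℂ] B, Φ a = T a ∧ Φ b = T b) (a b : K)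
    (W : Submodule ℂ H) [FiniteDimensional ℂ W] :
    ∃ P : K, (P : H →L[ℂ] H) = W.starProjection ∧
      T P * (T (a + b) - T a - T b) * T P = 0 := by
  classical
  let e := stdOrthonormalBasis ℂ W
  let x : Fin (Module.finrank ℂ W) → Fin (Module.finrank ℂ W) → K := fun i j =>
    ⟨rankOne ℂ (e i : H) (e j : H), (hK _).2 (aux_rankOne_compact _ _)⟩
  have hin : ∀ i j, inner ℂ (e i : H) (e j : H) = if i = j then (1 : ℂ) else 0 := by
    intro i j
    have := orthonormal_iff_ite.1 e.orthonormal i j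
    simpa using this
  have hstar : ∀ i j, star (x i j) = x j i := by
    intro i j
    apply Subtype.ext
    exact adjoint_rankOne _ _
  have hmul : ∀ i j k l, x i j * x k l = if j = k then x i l else 0 := by
    intro i j k l
    apply Subtype.ext
    have : ((x i j * x k l : K) : H →L[ℂ] H)
      = inner ℂ (e j : H) (e k : H) • rankOne ℂ (e i : H) (e l : H) := rankOne_comp_rankOne _ _ _ _
    rw [this, hin]
    split_ifs <;> simp [x]
  have hsand : ∀ i j (c : K), x i j * c * x i j
      = (inner ℂ (e j : H) ((c : H →L[ℂ] H) (e i : H))) • x i j := by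
    intro i j c
    apply Subtype.ext
    ext z
    simp [x, smul_smul, mul_comm]
  refine ⟨∑ i, x i i, ?_, ?_⟩
  · rw [e.starProjection_eq_sum_rankOne]
    simp [x]
  · rw [aux_sum T hT (fun i => x i i) (fun i j => by
      rw [hmul]; split_ifs with h <;> simp [h])]
    rw [Finset.sum_mul, Finset.sum_mul]
    apply Finset.sum_eq_zero
    intro j _
    rw [Finset.mul_sum]
    apply Finset.sum_eq_zero
    intro i _
    have := aux_defect T hT (x i j) a b _ _ (hsand i j a) (hsand i j b)
    simpa [hstar, hmul] using this

theorem aux_add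
    (K : NonUnitalStarSubalgebra ℂ (H →L[ℂ] H))
    (hK : ∀ f : H →L[ℂ] H, f ∈ K ↔ IsCompactOperator (f : H → H))
    (T : K → B)
    (hT : ∀ a b : K, ∃ Φ : K →⋆ₙₐ[ℂ] B, Φ a = T a ∧ Φ b = T b) (a b : K) :
    T (a + b) = T a + T b := by
  have hap : ∀ (c : K) {ε : ℝ}, 0 < ε → _ := fun c ε hε =>
    aux_approx2 (c : H →L[ℂ] H) ((hK _).1 c.2) ((hK _).1 (star c).2) hε
  rw [← sub_eq_zero, ← sub_sub, ← norm_le_zero_iff]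
  refine le_of_forall_pos_le_add fun ε hε => ?_
  have hε3 : 0 < ε / 3 := by positivity
  obtain ⟨V₁, _, h₁⟩ := hap (a + b) hε3
  obtain ⟨V₂, _, h₂⟩ := hap a hε3
  obtain ⟨V₃, _, h₃⟩ := hap b hε3
  let W := V₁ ⊔ V₂ ⊔ V₃
  have hW : FiniteDimensional ℂ W := inferInstance
  obtain ⟨P, hP, hPD⟩ := aux_proj K hK T hT a b W
  have h1 := h₁ W hW (le_sup_left.trans le_sup_left)
  have h2 := h₂ W hW (le_sup_right.trans le_sup_left)
  have h3 := h₃ W hW le_sup_right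
  have key : ∀ c : K, ‖W.starProjection * (c : H →L[ℂ] H) * W.starProjection - c‖ ≤ ε / 3 →
      ‖T P * T c * T P - T c‖ ≤ ε / 3 := by
    intro c hc
    obtain ⟨Φ, e1, e2⟩ := hT P c
    rw [← e1, ← e2, ← map_mul, ← map_mul, ← map_sub]
    refine (aux_contractive K hK Φ _).trans ?_
    rw [← hP] at hc
    exact hc
  have k1 := key _ h1
  have k2 := key _ h2
  have k3 := key _ h3
  have : T (a + b) - T a - T b = (T P * T a * T P - T a) + (T P * T b * T P - T b)
      - (T P * T (a + b) * T P - T (a + b)) := by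
    have h := hPD
    simp only [mul_sub, sub_mul] at h
    rw [← sub_eq_zero, ← h]; abel
  rw [this]
  calc _ ≤ ‖T P * T a * T P - T a‖ + ‖T P * T b * T P - T b‖
        + ‖T P * T (a + b) * T P - T (a + b)‖ :=
        (norm_sub_le _ _).trans (by gcongr; exact norm_add_le _ _)
    _ ≤ ε / 3 + ε / 3 + ε / 3 := by gcongr
    _ = 0 + ε := by ring

end main


variable {H : Type*} [NormedAddCommGroup H] [InnerProductSpace ℂ H] [CompleteSpace H]

variable {B : Type*}
  [NonUnitalNormedRing B] [StarRing B] [CStarRing B] [NormedSpace ℂ B]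
  [IsScalarTower ℂ B B] [SMulCommClass ℂ B B] [StarModule ℂ B] [CompleteSpace B]

/-- Let `K` be the C*-algebra of all compact operators on the complex Hilbert space `H`,
realized as a non-unital star subalgebra of `H →L[ℂ] H` whose elements are exactly the
compact operators. Then every (not necessarily linear) 2-local `*`-homomorphism
`T : K(H) → B` is linear and a `*`-homomorphism. -/
theorem twoLocalStarHom_compactOperators_linear
    (K : NonUnitalStarSubalgebra ℂ (H →L[ℂ] H))
    (hK : ∀ f : H →L[ℂ] H, f ∈ K ↔ IsCompactOperator (f : H → H))
    (T : K → B)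
    (hT : ∀ a b : K, ∃ Φ : K →⋆ₙₐ[ℂ] B, Φ a = T a ∧ Φ b = T b) :
    (∀ x y, T (x + y) = T x + T y) ∧ (∀ (c : ℂ) x, T (c • x) = c • T x) ∧
      (∀ x y, T (x * y) = T x * T y) ∧ (∀ x, T (star x) = star (T x)) := by
  exact aux_final T hT (aux_add K hK T hT)
end

section
/- Every (not necessarily linear nor continuous) 2-local Jordan *-homomorphism from a von Neumann algebra into a C*-algebra is linear and a Jordan *-homomorphism. -/
variable {H : Type*} [NormedAddCommGroup H] [InnerProductSpace ℂ H] [CompleteSpace H]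

variable {B : Type*}
  [NonUnitalNormedRing B] [StarRing B] [CStarRing B] [NormedSpace ℂ B]
  [IsScalarTower ℂ B B] [SMulCommClass ℂ B B] [StarModule ℂ B] [CompleteSpace B]

/-- A 2-local Jordan `*`-homomorphism from a von Neumann algebra `M` into a C*-algebra
`B`: for every pair of points there is a linear map `Φ` satisfying `Φ(a²) = Φ(a)²`
(equivalently, `Φ` preserves the Jordan product) and `Φ(a*) = Φ(a)*`, which agrees with
`T` at those two points. -/
def IsTwoLocalJordanStarHomVN (M : VonNeumannAlgebra H) (T : M.toStarSubalgebra → B) : Prop :=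
  ∀ a b : M.toStarSubalgebra,
    ∃ Φ : M.toStarSubalgebra →ₗ[ℂ] B,
      (∀ x, Φ (x * x) = Φ x * Φ x) ∧ (∀ x, Φ (star x) = star (Φ x)) ∧
        Φ a = T a ∧ Φ b = T b

namespace TwoLocalJordan

section Abstract

set_option linter.unusedSectionVars false

variable {A : Type*} [CStarAlgebra A] [PartialOrder A] [StarOrderedRing A]
variable {C : Type*} [NonUnitalCStarAlgebra C] [PartialOrder C] [StarOrderedRing C]

/-- Jordan star homomorphisms. -/
def IsJ (Φ : A →ₗ[ℂ] C) : Prop :=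
  (∀ x, Φ (x * x) = Φ x * Φ x) ∧ (∀ x, Φ (star x) = star (Φ x))

/-- Two-local Jordan star homomorphisms. -/
def IsTL (T : A → C) : Prop := ∀ a b, ∃ Φ : A →ₗ[ℂ] C, IsJ Φ ∧ Φ a = T a ∧ Φ b = T b

theorem IsJ.jmul {Φ : A →ₗ[ℂ] C} (h : IsJ Φ) (x y : A) :
    Φ (x * y + y * x) = Φ x * Φ y + Φ y * Φ x := by
  have h1 := h.1 (x + y)
  have e : (x + y) * (x + y) = x * x + (x * y + y * x) + y * y := by noncomm_ring
  rw [e, map_add, map_add, h.1, h.1, map_add Φ x y] at h1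
  have e2 : (Φ x + Φ y) * (Φ x + Φ y)
      = Φ x * Φ x + (Φ x * Φ y + Φ y * Φ x) + Φ y * Φ y := by
    simp only [mul_add, add_mul]; abel
  rw [e2] at h1
  exact add_left_cancel (add_right_cancel h1)

theorem IsJ.triple {Φ : A →ₗ[ℂ] C} (h : IsJ Φ) (x y : A) :
    Φ (x * y * x) = Φ x * Φ y * Φ x := by
  have h1 := h.jmul x (x * y + y * x)
  have h2 := h.jmul (x * x) y
  rw [h.jmul x y] at h1
  rw [h.1] at h2
  have e : x * (x * y + y * x) + (x * y + y * x) * x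
     = (x * x * y + y * (x * x)) + (2 : ℂ) • (x * y * x) := by
    rw [two_smul]; noncomm_ring
  have e' : Φ x * (Φ x * Φ y + Φ y * Φ x) + (Φ x * Φ y + Φ y * Φ x) * Φ x
     = (Φ x * Φ x * Φ y + Φ y * (Φ x * Φ x)) + (2 : ℂ) • (Φ x * Φ y * Φ x) := by
    rw [two_smul]; simp only [mul_add, add_mul, mul_assoc]; abel
  rw [e, e', map_add, h2, map_smul] at h1
  exact smul_right_injective C (two_ne_zero (α := ℂ)) (add_left_cancel h1)

theorem IsJ.nonneg {Φ : A →ₗ[ℂ] C} (h : IsJ Φ) {x : A} (hx : 0 ≤ x) : 0 ≤ Φ x := by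
  have e : CFC.sqrt x * CFC.sqrt x = x := CFC.sqrt_mul_sqrt_self x hx
  have hs : star (CFC.sqrt x) = CFC.sqrt x := (IsSelfAdjoint.of_nonneg (CFC.sqrt_nonneg x)).star_eq
  rw [← e, h.1]
  nth_rewrite 1 [← hs]
  rw [h.2]
  exact star_mul_self_nonneg _

theorem IsJ.norm_le {Φ : A →ₗ[ℂ] C} (h : IsJ Φ) {x : A} (hx : IsSelfAdjoint x) :
    ‖Φ x‖ ≤ ‖x‖ := by
  have h1 : x * x ≤ algebraMap ℝ A (‖x‖ * ‖x‖) := by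
    have := CStarAlgebra.star_mul_le_algebraMap_norm_sq (a := x)
    rwa [hx.star_eq, pow_two] at this
  have hΦ : star (Φ x) = Φ x := by rw [← h.2, hx.star_eq]
  have h2 : Φ x * Φ x ≤ (‖x‖ * ‖x‖) • Φ 1 := by
    rw [← sub_nonneg, ← h.1, ← LinearMap.map_smul_of_tower, ← map_sub]
    apply h.nonneg
    rw [sub_nonneg]
    rwa [Algebra.algebraMap_eq_smul_one] at h1
  have h3 : ‖Φ 1‖ ≤ 1 := by
    have e1 : Φ 1 * Φ 1 = Φ 1 := by rw [← h.1, mul_one]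
    have e2 : star (Φ 1) = Φ 1 := by rw [← h.2, star_one]
    have := CStarRing.norm_star_mul_self (x := Φ 1)
    rw [e2, e1] at this
    by_contra hc
    push Not at hc
    nlinarith
  have h0 : 0 ≤ Φ x * Φ x := by
    nth_rewrite 1 [← hΦ]
    exact star_mul_self_nonneg _
  have h4 := CStarAlgebra.norm_le_norm_of_nonneg_of_le h0 h2
  have h5 := CStarRing.norm_star_mul_self (x := Φ x)
  rw [hΦ] at h5
  rw [h5, norm_smul, Real.norm_eq_abs, abs_of_nonneg (by positivity)] at h4
  have : ‖Φ x‖ * ‖Φ x‖ ≤ ‖x‖ * ‖x‖ := by nlinarith [norm_nonneg x, norm_nonneg (Φ x)]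
  exact abs_le_of_sq_le_sq' (by nlinarith) (norm_nonneg _) |>.2

variable {T : A → C}

theorem IsTL.mono (hT : IsTL T) {a b : A} (h : a ≤ b) : T a ≤ T b := by
  obtain ⟨Φ, hΦ, ha, hb⟩ := hT a b
  rw [← ha, ← hb, ← sub_nonneg, ← map_sub]
  exact hΦ.nonneg (sub_nonneg.2 h)

theorem IsTL.smul (hT : IsTL T) (c : ℂ) (a : A) : T (c • a) = c • T a := by
  obtain ⟨Φ, hΦ, ha, hb⟩ := hT a (c • a)
  rw [← ha, ← hb, map_smul]

theorem IsTL.rsmul (hT : IsTL T) (c : ℝ) (a : A) : T (c • a) = c • T a := by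
  obtain ⟨Φ, hΦ, ha, hb⟩ := hT a (c • a)
  rw [← ha, ← hb, LinearMap.map_smul_of_tower]

theorem IsTL.star (hT : IsTL T) (a : A) : T (star a) = star (T a) := by
  obtain ⟨Φ, hΦ, ha, hb⟩ := hT a (Star.star a)
  rw [← ha, ← hb, hΦ.2]

theorem IsTL.sq (hT : IsTL T) (a : A) : T (a * a) = T a * T a := by
  obtain ⟨Φ, hΦ, ha, hb⟩ := hT a (a * a)
  rw [← ha, ← hb, hΦ.1]

theorem IsTL.triple' (hT : IsTL T) {p k : A} (h : p * k * p = k) : T p * T k * T p = T k := by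
  obtain ⟨Φ, hΦ, ha, hb⟩ := hT p k
  rw [← ha, ← hb, ← hΦ.triple, h]

theorem unit_of_triple {P K : C} (hP : P * P = P) (h : P * K * P = K) : P * K = K ∧ K * P = K := by
  constructor
  · rw [← h]; simp only [← mul_assoc, hP]
  · rw [← h]; simp only [mul_assoc, hP]

theorem zero_of_star_mul {x : C} (h : star x * x ≤ 0) : x = 0 :=
  CStarRing.star_mul_self_eq_zero_iff x |>.1 (le_antisymm h (star_mul_self_nonneg x))

theorem IsTL.proj (hT : IsTL T) {p : A} (hp : p * p = p) : T p * T p = T p := by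
  rw [← hT.sq, hp]

theorem IsTL.sa (hT : IsTL T) {p : A} (hp : Star.star p = p) : Star.star (T p) = T p := by
  rw [← hT.star, hp]

/-- Key comparison: if `x ≥ p` lies in the corner of `p`, translation by multiples of `p`. -/
theorem IsTL.corner_aux (hT : IsTL T) {p x : A} (hp : p * p = p) (hps : Star.star p = p)
    (hx : p * x * p = x) (hpx : p ≤ x) (t : ℝ) (ht : t ≠ 0) :
    T (x + t • p) = T x + t • T p := by
  obtain ⟨Φ, hΦ, ha, hb⟩ := hT (x + t • p) x
  have hP := hT.proj hp
  have hPs := hT.sa hps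
  set P := T p
  have hQ : Φ p * Φ p = Φ p := by rw [← hΦ.1, hp]
  have hQs : Star.star (Φ p) = Φ p := by rw [← hΦ.2, hps]
  have hQX : Φ p * T x * Φ p = T x := by rw [← hb, ← hΦ.triple, hx]
  obtain ⟨hQX1, hQX2⟩ := unit_of_triple hQ hQX
  have hPX := unit_of_triple hP (hT.triple' hx)
  have hxt : p * (x + t • p) * p = x + t • p := by
    rw [mul_add, add_mul, hx, mul_smul_comm, smul_mul_assoc, hp, hp]
  have hPX' := unit_of_triple hP (hT.triple' hxt)
  have e : T (x + t • p) = T x + t • Φ p := by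
    rw [← ha, ← hb, map_add, LinearMap.map_smul_of_tower]
  have eQ : Φ p = t⁻¹ • (T (x + t • p) - T x) := by
    rw [e, add_sub_cancel_left, smul_smul, inv_mul_cancel₀ ht, one_smul]
  have hPQ : P * Φ p = Φ p := by
    rw [eQ, mul_smul_comm, mul_sub, hPX.1, hPX'.1]
  have hQP : Φ p * P = Φ p := by
    rw [eQ, smul_mul_assoc, sub_mul, hPX.2, hPX'.2]
  have hle : P ≤ T x := hT.mono hpx
  have h1 := star_left_conjugate_le_conjugate hle (P - Φ p)
  have h2 : T x * (P - Φ p) = 0 := by rw [mul_sub, hPX.2, hQX2, sub_self]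
  have h3 : P * (P - Φ p) = P - Φ p := by rw [mul_sub, hP, hPQ]
  rw [mul_assoc, mul_assoc, h2, h3, mul_zero] at h1
  have h4 := zero_of_star_mul h1
  rw [e, ← sub_eq_zero.1 h4]

theorem IsTL.corner (hT : IsTL T) {p k : A} (hp : p * p = p) (hps : Star.star p = p)
    (hk : p * k * p = k) (hks : IsSelfAdjoint k) (t : ℝ) :
    T (k + t • p) = T k + t • T p := by
  have hle : -k ≤ ‖k‖ • (1 : A) := by
    have := hks.neg.le_algebraMap_norm_self
    rwa [norm_neg, Algebra.algebraMap_eq_smul_one] at this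
  have hle2 := star_left_conjugate_le_conjugate hle p
  rw [hps, mul_neg, neg_mul, hk, mul_smul_comm, smul_mul_assoc, mul_one, hp] at hle2
  have key : ∀ s : ℝ, ‖k‖ + 1 ≤ s → ∀ t : ℝ, T (k + t • p) = T (k + s • p) + (t - s) • T p := by
    intro s hs t
    by_cases hts : t = s
    · subst hts; simp
    have hpx : p ≤ k + s • p := by
      have hp0 : 0 ≤ p := by
        have := star_mul_self_nonneg p
        rwa [hps, hp] at this
      have h0 : 0 ≤ (s - (‖k‖ + 1)) • p := smul_nonneg (by linarith) hp0
      have h1 : 0 ≤ k + ‖k‖ • p := by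
        have := sub_nonneg.2 hle2
        rwa [sub_neg_eq_add, add_comm] at this
      rw [← sub_nonneg]
      have : k + s • p - p = (k + ‖k‖ • p) + (s - (‖k‖ + 1)) • p := by module
      rw [this]
      exact add_nonneg h1 h0
    have hx : p * (k + s • p) * p = k + s • p := by
      rw [mul_add, add_mul, hk, mul_smul_comm, smul_mul_assoc, hp, hp]
    rw [← hT.corner_aux hp hps hx hpx (t - s) (sub_ne_zero.2 hts)]
    congr 1
    module
  have h1 := key _ le_rfl t
  have h2 := key _ le_rfl 0
  rw [zero_smul, add_zero] at h2
  rw [h1, h2]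
  module

theorem IsTL.add_one (hT : IsTL T) {k : A} (hks : IsSelfAdjoint k) (t : ℝ) :
    T (k + t • 1) = T k + t • T 1 :=
  hT.corner (mul_one 1) (star_one A) (by simp) hks t

theorem eq_zero_of_corner {P K D : C} (hK : P ≤ K) (hDs : star D = D) (hPD : P * D = D) (h : K * D * K = 0) : D = 0 := by
  have h1 := star_left_conjugate_le_conjugate hK (D * K)
  have e1 : star (D * K) * P * (D * K) = star (D * K) * (D * K) := by
    rw [mul_assoc, ← mul_assoc P, hPD]
  have e2 : star (D * K) * K * (D * K) = 0 := by
    rw [mul_assoc, ← mul_assoc K, h, mul_zero]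
  rw [e1, e2] at h1
  have h2 := zero_of_star_mul h1
  have h3 := star_left_conjugate_le_conjugate hK D
  rw [hDs, mul_assoc, hPD, h2, zero_mul] at h3
  apply zero_of_star_mul
  rwa [hDs]

theorem IsTL.compress (hT : IsTL T) {p a : A} (hp : p * p = p) (hps : Star.star p = p)
    (ha : IsSelfAdjoint a) : T (p * a * p) = T p * T a * T p := by
  have key : ∀ a : A, 1 ≤ a → IsSelfAdjoint a → T (p * a * p) = T p * T a * T p := by
    intro a h1a ha
    have hks : Star.star (p * a * p) = p * a * p := by
      simp [hps, ha.star_eq, mul_assoc]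
    have hpk : p ≤ p * a * p := by
      have := star_left_conjugate_le_conjugate h1a p
      rwa [hps, mul_one, hp] at this
    have hkk : p * (p * a * p) * p = p * a * p := by
      simp only [mul_assoc, hp]; simp only [← mul_assoc, hp]
    have hP := hT.proj hp
    have hPs := hT.sa hps
    obtain ⟨hPK, hKP⟩ := unit_of_triple hP (hT.triple' hkk)
    have h3 : T (p * a * p) * T a * T (p * a * p)
        = T (p * a * p) * T (p * a * p) * T (p * a * p) := by
      obtain ⟨Φ, hΦ, h1, h2⟩ := hT (p * a * p) a
      rw [← h1, ← h2, ← hΦ.triple, ← hΦ.triple]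
      congr 1
      have e1 : p * a * p * p = p * a * p := by rw [mul_assoc, hp]
      have e2 : p * (p * a * p) = p * a * p := by simp only [← mul_assoc, hp]
      calc p * a * p * a * (p * a * p) = (p * a * p * p) * a * (p * (p * a * p)) := by rw [e1, e2]
        _ = _ := by simp only [mul_assoc]
    have hKs := hT.sa hks
    have hle : T p ≤ T (p * a * p) := hT.mono hpk
    have has := hT.sa ha.star_eq
    generalize T (p * a * p) = K at *
    generalize T p = P at *
    generalize T a = X at *
    symm
    rw [← sub_eq_zero]
    apply eq_zero_of_corner hle
    · simp [hPs, hKs, has, mul_assoc]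
    · simp only [mul_sub, ← mul_assoc, hP, hPK]
    · rw [mul_sub, sub_mul, sub_eq_zero]
      have : K * (P * X * P) * K = (K * P) * X * (P * K) := by simp only [mul_assoc]
      rw [this, hPK, hKP, h3]
  have h1 : 1 ≤ a + (‖a‖ + 1) • (1 : A) := by
    have := ha.neg.le_algebraMap_norm_self
    rw [norm_neg, Algebra.algebraMap_eq_smul_one, ← sub_nonneg] at this
    rw [← sub_nonneg]
    convert this using 1
    module
  have h2 := key _ h1 (ha.add ((IsSelfAdjoint.all (‖a‖ + 1)).smul (.one A)))
  have hkk : p * (p * a * p) * p = p * a * p := by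
    simp only [mul_assoc, hp]; simp only [← mul_assoc, hp]
  have hks : Star.star (p * a * p) = p * a * p := by
    simp [hps, ha.star_eq, mul_assoc]
  have h11 : T p * T 1 * T p = T p := by
    obtain ⟨Φ, hΦ, h1, h2⟩ := hT p 1
    rw [← h1, ← h2, ← hΦ.triple, mul_one, hp]
  rw [hT.add_one ha, mul_add, add_mul, mul_add, add_mul, mul_smul_comm, smul_mul_assoc,
    mul_smul_comm, smul_mul_assoc, h11, mul_one, hp, hT.corner hp hps hkk hks] at h2
  exact add_right_cancel h2

theorem IsTL.add_proj (hT : IsTL T) {p b : A} (hp : p * p = p) (hps : Star.star p = p)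
    (hb : IsSelfAdjoint b) : T (p + b) = T p + T b := by
  have hp' : (1 - p) * (1 - p) = 1 - p := by simp [mul_sub, sub_mul, hp]
  have hps' : Star.star (1 - p) = 1 - p := by simp [hps]
  obtain ⟨Φ, hΦ, h1, h2⟩ := hT (p + b) b
  have hQ : Φ p * Φ p = Φ p := by rw [← hΦ.1, hp]
  have hQs : Star.star (Φ p) = Φ p := by rw [← hΦ.2, hps]
  have eQ : Φ p = T (p + b) - T b := by rw [← h1, ← h2, map_add, add_sub_cancel_right]
  have hpb : IsSelfAdjoint (p + b) := IsSelfAdjoint.add hps hb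
  have hPQP : T p * Φ p * T p = T p := by
    rw [eQ, mul_sub, sub_mul, ← hT.compress hp hps hpb, ← hT.compress hp hps hb, mul_add, add_mul,
      hp, hp]
    have hkk : p * (p * b * p) * p = p * b * p := by
      simp only [mul_assoc, hp]; simp only [← mul_assoc, hp]
    have hks : Star.star (p * b * p) = p * b * p := by
      simp [hps, hb.star_eq, mul_assoc]
    have := hT.corner hp hps hkk hks 1
    rw [one_smul, one_smul] at this
    rw [add_comm p, this, add_sub_cancel_left]
  have hPQP' : T (1 - p) * Φ p * T (1 - p) = 0 := by
    rw [eQ, mul_sub, sub_mul, ← hT.compress hp' hps' hpb, ← hT.compress hp' hps' hb, mul_add,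
      sub_mul 1 p p, hp, one_mul, sub_self, zero_add, sub_self]
  have hP' : T (1 - p) = T 1 - T p := by
    have hpn : IsSelfAdjoint (-p) := IsSelfAdjoint.neg hps
    have := hT.add_one hpn 1
    have hn := hT.rsmul (-1) p
    simp only [neg_smul, one_smul] at hn this
    rw [hn] at this
    rw [sub_eq_add_neg, add_comm, this]; abel
  have hPs' := hT.sa hps'
  have hI : ∀ x, T x * T 1 = T x := fun x =>
    (unit_of_triple (hT.proj (mul_one 1)) (hT.triple' (by simp))).2
  have hQP' : Φ p * T (1 - p) = 0 := by
    apply zero_of_star_mul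
    rw [star_mul, hQs, hPs', mul_assoc, ← mul_assoc (Φ p), hQ, ← mul_assoc, hPQP']
  have hQI : Φ p * T 1 = Φ p := by rw [eQ, sub_mul, hI, hI]
  have hQP : Φ p * T p = Φ p := by
    rw [hP', mul_sub, hQI, sub_eq_zero] at hQP'
    exact hQP'.symm
  have hPQ : T p * Φ p = Φ p := by
    have := congrArg Star.star hQP
    rwa [star_mul, hQs, hT.sa hps] at this
  have : Φ p = T p := by rw [← hPQP, hPQ, hQP]
  rw [← this, ← h1, ← h2, map_add]

/-- Self-adjoint elements along which `T` is additive. -/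
def addSub (hT : IsTL T) : Submodule ℝ A where
  carrier := {a | IsSelfAdjoint a ∧ ∀ b, IsSelfAdjoint b → T (a + b) = T a + T b}
  zero_mem' := ⟨.zero A, fun b _ => by
    have := hT.rsmul 0 0
    simp only [zero_smul] at this
    rw [this]; simp⟩
  add_mem' := by
    rintro a a' ⟨h1, h2⟩ ⟨h3, h4⟩
    refine ⟨h1.add h3, fun b hb => ?_⟩
    rw [add_assoc, h2 _ (h3.add hb), h4 _ hb, h2 _ h3, add_assoc]
  smul_mem' := by
    rintro c a ⟨h1, h2⟩
    refine ⟨(IsSelfAdjoint.all c).smul h1, fun b hb => ?_⟩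
    by_cases hc : c = 0
    · subst hc
      have := hT.rsmul 0 0
      simp only [zero_smul] at this
      simp [this]
    have e : c • a + b = c • (a + c⁻¹ • b) := by
      rw [smul_add, smul_smul, mul_inv_cancel₀ hc, one_smul]
    rw [e, hT.rsmul, h2 _ ((IsSelfAdjoint.all c⁻¹).smul hb), hT.rsmul, hT.rsmul, smul_add, smul_smul,
      mul_inv_cancel₀ hc, one_smul]

theorem mem_addSub_proj (hT : IsTL T) {p : A} (hp : p * p = p) (hps : Star.star p = p) :
    p ∈ addSub hT := ⟨hps, fun _ hb => hT.add_proj hp hps hb⟩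

/-- Supply of projections. -/
def HasProj (A : Type*) [CStarAlgebra A] [PartialOrder A] : Prop :=
  ∀ x y : A, 0 ≤ x → 0 ≤ y → y * x = 0 →
    ∃ p : A, p * p = p ∧ star p = p ∧ p * x = x ∧ y * p = 0

theorem HasProj.half (hA : HasProj A) {a : A} (h0 : 0 ≤ a) (h1 : a ≤ 1) :
    ∃ p : A, p * p = p ∧ star p = p ∧ 0 ≤ a - (1 / 2 : ℝ) • p ∧
      a - (1 / 2 : ℝ) • p ≤ (1 / 2 : ℝ) • 1 := by
  set c : A := a - (1 / 2 : ℝ) • 1 with hc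
  have hcs : IsSelfAdjoint c :=
    (IsSelfAdjoint.of_nonneg h0).sub ((IsSelfAdjoint.all (1 / 2 : ℝ)).smul (.one A))
  obtain ⟨p, hp, hps, hpx, hyp⟩ := hA c⁺ c⁻ (CFC.posPart_nonneg c) (CFC.negPart_nonneg c)
    (CFC.negPart_mul_posPart c)
  have hsub : c⁺ - c⁻ = c := CFC.posPart_sub_negPart c
  have hx0 : 0 ≤ c⁺ := CFC.posPart_nonneg c
  have hy0 : 0 ≤ c⁻ := CFC.negPart_nonneg c
  generalize c⁺ = x at *
  generalize c⁻ = y at *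
  have hxp : x * p = x := by
    have := congrArg star hpx
    rwa [star_mul, hps, (IsSelfAdjoint.of_nonneg hx0).star_eq] at this
  have hpy : p * y = 0 := by
    have := congrArg star hyp
    rwa [star_mul, hps, (IsSelfAdjoint.of_nonneg hy0).star_eq, star_zero] at this
  have ha : a = x - y + (1 / 2 : ℝ) • 1 := by rw [hsub, hc]; abel
  have hx : x ≤ (1 / 2 : ℝ) • p := by
    have := star_left_conjugate_le_conjugate h1 p
    rw [hps, ha, mul_one, hp, mul_add, add_mul, mul_sub, sub_mul, hpx, hxp, hpy, zero_mul,
      sub_zero, mul_smul_comm, smul_mul_assoc, mul_one, hp, ← sub_nonneg] at this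
    rw [← sub_nonneg]
    convert this using 1
    module
  have hy : y ≤ (1 / 2 : ℝ) • (1 - p) := by
    have := star_left_conjugate_nonneg h0 (1 - p)
    rw [star_sub, star_one, hps, ha] at this
    have e : (1 - p) * (x - y + (1 / 2 : ℝ) • 1) * (1 - p) = (1 / 2 : ℝ) • (1 - p) - y := by
      simp only [mul_add, add_mul, mul_sub, sub_mul, mul_one, one_mul, hpx, hxp, hpy, hyp,
        mul_smul_comm, smul_mul_assoc, hp, zero_mul]
      module
    rw [e] at this
    exact sub_nonneg.1 this
  refine ⟨p, hp, hps, ?_, ?_⟩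
  · have e : a - (1 / 2 : ℝ) • p = x + ((1 / 2 : ℝ) • (1 - p) - y) := by rw [ha]; module
    rw [e]
    exact add_nonneg hx0 (sub_nonneg.2 hy)
  · rw [← sub_nonneg]
    have e : (1 / 2 : ℝ) • 1 - (a - (1 / 2 : ℝ) • p) = ((1 / 2 : ℝ) • p - x) + y := by
      rw [ha]; module
    rw [e]
    exact add_nonneg (sub_nonneg.2 hx) hy0

theorem HasProj.approx (hA : HasProj A) (hT : IsTL T) (n : ℕ) : ∀ a : A, 0 ≤ a → a ≤ 1 →
    ∃ s ∈ addSub hT, 0 ≤ a - s ∧ a - s ≤ ((1 / 2 : ℝ) ^ n) • 1 := by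
  induction n with
  | zero => intro a h0 h1; exact ⟨0, zero_mem _, by simpa using h0, by simpa using h1⟩
  | succ n ih =>
    intro a h0 h1
    obtain ⟨p, hp, hps, h2, h3⟩ := hA.half h0 h1
    have h2' : 0 ≤ (2 : ℝ) • (a - (1 / 2 : ℝ) • p) := smul_nonneg (by norm_num) h2
    have h3' : (2 : ℝ) • (a - (1 / 2 : ℝ) • p) ≤ 1 := by
      have := smul_le_smul_of_nonneg_left h3 (show (0 : ℝ) ≤ 2 by norm_num)
      rwa [smul_smul, show (2 : ℝ) * (1 / 2) = 1 by norm_num, one_smul] at this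
    obtain ⟨s, hs, h4, h5⟩ := ih _ h2' h3'
    refine ⟨(1 / 2 : ℝ) • p + (1 / 2 : ℝ) • s,
      add_mem (Submodule.smul_mem _ _ (mem_addSub_proj hT hp hps)) (Submodule.smul_mem _ _ hs), ?_⟩
    have e : a - ((1 / 2 : ℝ) • p + (1 / 2 : ℝ) • s)
        = (1 / 2 : ℝ) • ((2 : ℝ) • (a - (1 / 2 : ℝ) • p) - s) := by module
    rw [e]
    refine ⟨smul_nonneg (by norm_num) h4, ?_⟩
    have := smul_le_smul_of_nonneg_left h5 (show (0 : ℝ) ≤ 1 / 2 by norm_num)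
    rwa [smul_smul, ← pow_succ'] at this

theorem IsTL.lip (hT : IsTL T) {a b : A} (ha : IsSelfAdjoint a) (hb : IsSelfAdjoint b) :
    ‖T a - T b‖ ≤ ‖a - b‖ := by
  obtain ⟨Φ, hΦ, h1, h2⟩ := hT a b
  rw [← h1, ← h2, ← map_sub]
  exact hΦ.norm_le (ha.sub hb)

theorem HasProj.mem_unit (hA : HasProj A) (hT : IsTL T) {a : A} (h0 : 0 ≤ a) (h1 : a ≤ 1) :
    a ∈ addSub hT := by
  have ha := IsSelfAdjoint.of_nonneg h0
  refine ⟨ha, fun b hb => ?_⟩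
  have key : ∀ n : ℕ, ‖T (a + b) - (T a + T b)‖ ≤ 2 * (‖(1 : A)‖ * (1 / 2 : ℝ) ^ n) := by
    intro n
    obtain ⟨s, ⟨hs, hs'⟩, h2, h3⟩ := hA.approx hT n a h0 h1
    have hn := CStarAlgebra.norm_le_norm_of_nonneg_of_le h2 h3
    rw [norm_smul, Real.norm_eq_abs, abs_of_nonneg (by positivity)] at hn
    have l1 := hT.lip (ha.add hb) (hs.add hb)
    have l2 := hT.lip ha hs
    rw [add_sub_add_right_eq_sub] at l1
    have e : T (a + b) - (T a + T b) = (T (a + b) - T (s + b)) - (T a - T s) := by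
      rw [hs' b hb]; abel
    rw [e]
    refine (norm_sub_le _ _).trans ?_
    linarith
  have lim : Filter.Tendsto (fun n : ℕ => 2 * (‖(1 : A)‖ * (1 / 2 : ℝ) ^ n)) Filter.atTop
      (nhds (2 * (‖(1 : A)‖ * 0))) :=
    ((tendsto_pow_atTop_nhds_zero_of_lt_one (by norm_num) (by norm_num)).const_mul _).const_mul _
  have := ge_of_tendsto' lim key
  simp only [mul_zero] at this
  exact sub_eq_zero.1 (norm_le_zero_iff.1 this)

theorem HasProj.mem_sa (hA : HasProj A) (hT : IsTL T) {a : A} (ha : IsSelfAdjoint a) :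
    a ∈ addSub hT := by
  have h1 : (1 : A) ∈ addSub hT := mem_addSub_proj hT (mul_one 1) (star_one A)
  have hpos : (0 : ℝ) < 2 * ‖a‖ + 1 := by positivity
  have l1 := ha.neg.le_algebraMap_norm_self
  have l2 := ha.le_algebraMap_norm_self
  rw [norm_neg, Algebra.algebraMap_eq_smul_one, ← sub_nonneg] at l1
  rw [Algebra.algebraMap_eq_smul_one, ← sub_nonneg] at l2
  have h2 : (2 * ‖a‖ + 1)⁻¹ • (a + ‖a‖ • (1 : A)) ∈ addSub hT := by
    apply hA.mem_unit
    · apply smul_nonneg (by positivity)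
      convert l1 using 1
      abel
    · have : (2 * ‖a‖ + 1)⁻¹ • (a + ‖a‖ • (1 : A)) ≤ (2 * ‖a‖ + 1)⁻¹ • ((2 * ‖a‖ + 1) • 1) := by
        apply smul_le_smul_of_nonneg_left _ (by positivity)
        rw [← sub_nonneg]
        have e : (2 * ‖a‖ + 1) • (1 : A) - (a + ‖a‖ • (1 : A)) = (‖a‖ • 1 - a) + 1 := by module
        rw [e]
        exact add_nonneg l2 zero_le_one
      rwa [smul_smul, inv_mul_cancel₀ hpos.ne', one_smul] at this
  have e : a = (2 * ‖a‖ + 1) • ((2 * ‖a‖ + 1)⁻¹ • (a + ‖a‖ • (1 : A))) - ‖a‖ • 1 := by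
    rw [smul_smul, mul_inv_cancel₀ hpos.ne', one_smul]; abel
  rw [e]
  exact sub_mem (Submodule.smul_mem _ _ h2) (Submodule.smul_mem _ _ h1)

theorem IsTL.re (hT : IsTL T) (z : A) :
    T (z + Star.star z) = T z + Star.star (T z) := by
  obtain ⟨Φ, hΦ, h1, h2⟩ := hT z (z + Star.star z)
  rw [← h1, ← h2, map_add, hΦ.2]

theorem HasProj.additive (hA : HasProj A) (hT : IsTL T) (x y : A) : T (x + y) = T x + T y := by
  have key : ∀ x y : A, T (x + y) + star (T (x + y)) = (T x + T y) + star (T x + T y) := by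
    intro x y
    have e : x + y + star (x + y) = (x + star x) + (y + star y) := by rw [star_add]; abel
    rw [← hT.re, e, (hA.mem_sa hT (IsSelfAdjoint.add_star_self x)).2 _
      (IsSelfAdjoint.add_star_self y), hT.re, hT.re, star_add]
    abel
  have h1 := key x y
  have h2 := key (Complex.I • x) (Complex.I • y)
  rw [← smul_add, hT.smul, hT.smul, hT.smul, ← smul_add, star_smul, star_smul] at h2
  have hI : star Complex.I = - Complex.I := Complex.conj_I
  rw [hI, neg_smul, neg_smul, ← sub_eq_add_neg, ← sub_eq_add_neg, ← smul_sub, ← smul_sub] at h2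
  have h3 := smul_right_injective C Complex.I_ne_zero h2
  generalize T (x + y) = u at *
  generalize T x + T y = v at *
  have h4 : (2 : ℂ) • u = (2 : ℂ) • v := by
    calc (2 : ℂ) • u = (u + star u) + (u - star u) := by rw [two_smul]; abel
      _ = (v + star v) + (v - star v) := by rw [h1, h3]
      _ = (2 : ℂ) • v := by rw [two_smul]; abel
  exact smul_right_injective C (two_ne_zero (α := ℂ)) h4

end Abstract

theorem hasProj_vn {H : Type*} [NormedAddCommGroup H] [InnerProductSpace ℂ H] [CompleteSpace H]
    (M : VonNeumannAlgebra H) (x y : M.toStarSubalgebra) (h : y * x = 0) :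
    ∃ p : M.toStarSubalgebra, p * p = p ∧ star p = p ∧ p * x = x ∧ y * p = 0 := by
  let U : Submodule ℂ H := (x : H →L[ℂ] H).range.topologicalClosure
  haveI : CompleteSpace U := (Submodule.isClosed_topologicalClosure _).completeSpace_coe
  have hp := isStarProjection_starProjection (U := U)
  have hmem : U.starProjection ∈ M := by
    rw [VonNeumannAlgebra.IsStarProjection.mem_iff hp]
    intro z hz
    have hzx := VonNeumannAlgebra.mem_commutant_iff.1 hz x x.2
    rw [Submodule.range_starProjection]
    intro v hv
    have : Set.MapsTo z (x : H →L[ℂ] H).range (x : H →L[ℂ] H).range := by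
      rintro _ ⟨w, rfl⟩
      exact ⟨z w, congrArg (fun f : H →L[ℂ] H => f w) hzx⟩
    exact this.closure z.continuous hv
  refine ⟨⟨U.starProjection, hmem⟩, ?_, ?_, ?_, ?_⟩
  · exact Subtype.ext hp.isIdempotentElem
  · exact Subtype.ext hp.isSelfAdjoint.star_eq
  · apply Subtype.ext
    ext v
    exact Submodule.starProjection_eq_self_iff.2 (Submodule.le_topologicalClosure _ ⟨v, rfl⟩)
  · apply Subtype.ext
    ext v
    have hU : U ≤ (y : H →L[ℂ] H).ker := by
      apply Submodule.topologicalClosure_minimal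
      · rintro _ ⟨w, rfl⟩
        exact congrArg (fun f : M.toStarSubalgebra => (f : H →L[ℂ] H) w) h
      · exact (y : H →L[ℂ] H).isClosed_ker
    exact hU (Submodule.starProjection_apply_mem U v)

theorem isClosed_vn {H : Type*} [NormedAddCommGroup H] [InnerProductSpace ℂ H] [CompleteSpace H]
    (M : VonNeumannAlgebra H) : IsClosed (M.toStarSubalgebra : Set (H →L[ℂ] H)) := by
  rw [VonNeumannAlgebra.coe_toStarSubalgebra, ← M.centralizer_centralizer]
  exact Set.isClosed_centralizer _

end TwoLocalJordan

/-- Every (not necessarily linear nor continuous) 2-local Jordan `*`-homomorphism from a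
von Neumann algebra into a C*-algebra is linear and a Jordan `*`-homomorphism. -/
theorem twoLocalJordanStarHom_vonNeumann_linear (M : VonNeumannAlgebra H)
    (T : M.toStarSubalgebra → B) (hT : IsTwoLocalJordanStarHomVN M T) :
    (∀ x y, T (x + y) = T x + T y) ∧ (∀ (c : ℂ) x, T (c • x) = c • T x) ∧
      (∀ x, T (x * x) = T x * T x) ∧ (∀ x, T (star x) = star (T x)) := by
  have : IsClosed (M.toStarSubalgebra : Set (H →L[ℂ] H)) := TwoLocalJordan.isClosed_vn M
  letI : NonUnitalCStarAlgebra B := {}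
  letI : PartialOrder B := CStarAlgebra.spectralOrder B
  have : StarOrderedRing B := CStarAlgebra.spectralOrderedRing B
  letI : PartialOrder M.toStarSubalgebra := CStarAlgebra.spectralOrder _
  have : StarOrderedRing M.toStarSubalgebra := CStarAlgebra.spectralOrderedRing _
  have hT' : TwoLocalJordan.IsTL T := by
    intro a b
    obtain ⟨Φ, h1, h2, h3, h4⟩ := hT a b
    exact ⟨Φ, ⟨h1, h2⟩, h3, h4⟩
  have hA : TwoLocalJordan.HasProj M.toStarSubalgebra := fun x y _ _ h =>
    TwoLocalJordan.hasProj_vn M x y h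
  exact ⟨hA.additive hT', hT'.smul, hT'.sq, hT'.star⟩
end
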